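/- Suppose γ > 0, 1 < q < ∞, α ∈ ℝ, 0 < p < ∞, and k is a nonnegative integer with pk + α > −1. For a holomorphic function f on 𝔹_n, f belongs to the generalized Bergman space A^p_α if and only if A_γ^{(q)}(R^{k+1} f) ∈ L^p(𝔹_n, dv_α), where A_γ^{(q)}(R^m f)(z) = (∫_{D(z,γ)} |(1−|w|²)^m R^m f(w)|^q dτ(w))^{1/q}. Moreover there is a constant C > 0, depending only on γ, q, α, p, k, n, such that C^{-1}(|f(0)| + ‖A_γ^{(q)}(R^{k+1} f)‖_{L^p(dv_α)}) ≤ ‖f‖_{p,α} ≤ C(|f(0)| + ‖A_γ^{(q)}(R^{k+1} f)‖_{L^p(dv_α)}). -/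

import Mathlib

open MeasureTheory Filter Topology
open scoped Classical ENNReal

noncomputable section

/-- `ℂⁿ` with the Euclidean norm. -/
abbrev En (n : ℕ) := EuclideanSpace ℂ (Fin n)

instance (n : ℕ) : MeasurableSpace (En n) := borel _
instance (n : ℕ) : BorelSpace (En n) := ⟨rfl⟩

/-- The Lebesgue volume measure on `ℂⁿ`. -/
def vol (n : ℕ) : Measure (En n) := Measure.addHaar

/-- The open unit ball `𝔹ₙ` of `ℂⁿ`. -/
def uball (n : ℕ) : Set (En n) := Metric.ball 0 1

/-- The Hermitian pairing `⟨z,w⟩ = ∑ⱼ zⱼ * conj wⱼ`. -/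
def herm {n : ℕ} (z w : En n) : ℂ := ∑ j, z j * (starRingEnd ℂ) (w j)

/-- The orthogonal projection `P_z w` onto the line spanned by `z`. -/
def prj {n : ℕ} (z w : En n) : En n :=
  if z = 0 then 0 else (herm w z / herm z z) • z

/-- The Möbius automorphism `φ_z` of the unit ball. -/
def mobius {n : ℕ} (z w : En n) : En n :=
  ((1 : ℂ) / (1 - herm w z)) •
    (z - prj z w - ((Real.sqrt (1 - ‖z‖ ^ 2) : ℝ) : ℂ) • (w - prj z w))

/-- The Bergman metric `β(z,w)`. -/
def bmet {n : ℕ} (z w : En n) : ℝ :=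
  (1 / 2) * Real.log ((1 + ‖mobius z w‖) / (1 - ‖mobius z w‖))

/-- The Bergman metric ball `D(z,γ)`. -/
def Dball {n : ℕ} (z : En n) (γ : ℝ) : Set (En n) :=
  {w | w ∈ uball n ∧ bmet z w < γ}

/-- The normalizing constant `c_α`. -/
def cnorm (n : ℕ) (α : ℝ) : ℝ :=
  if -1 < α then Real.Gamma (n + α + 1) / (n.factorial * Real.Gamma (α + 1)) else 1

/-- The weighted measure `dv_α = c_α (1-|z|²)^α dv` on the unit ball. -/
def measA (n : ℕ) (α : ℝ) : Measure (En n) :=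
  ((vol n).restrict (uball n)).withDensity
    (fun z => ENNReal.ofReal (cnorm n α * (1 - ‖z‖ ^ 2) ^ α))

/-- The invariant measure `dτ = (1-|z|²)^{-(n+1)} dv` on the unit ball. -/
def measTau (n : ℕ) : Measure (En n) :=
  ((vol n).restrict (uball n)).withDensity
    (fun z => ENNReal.ofReal ((1 - ‖z‖ ^ 2) ^ (-((n : ℝ) + 1))))

/-- The Bergman space (quasi-)norm `‖f‖_{p,α}`, valued in `ℝ≥0∞`. -/
def apnorm (n : ℕ) (p α : ℝ) (f : En n → ℂ) : ℝ≥0∞ :=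
  (∫⁻ z, ENNReal.ofReal (‖f z‖ ^ p) ∂measA n α) ^ (1 / p)

/-- The radial derivative `Rf(z) = ∑ z_k ∂f/∂z_k = Df(z)[z]`. -/
def radD {n : ℕ} (f : En n → ℂ) (z : En n) : ℂ := fderiv ℂ f z z

/-- Iterated radial derivative `R^k f`. -/
def radIter {n : ℕ} : ℕ → (En n → ℂ) → En n → ℂ
  | 0, f => f
  | (k + 1), f => radD (radIter k f)

/-- The pseudo-metric `ϱ` on the unit ball. -/
def rho {n : ℕ} (z w : En n) : ℝ :=
  if z ≠ 0 ∧ w ≠ 0 then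
    |‖z‖ - ‖w‖| + ‖1 - herm z w / ((‖z‖ : ℂ) * (‖w‖ : ℂ))‖
  else ‖z‖ + ‖w‖

/-- The area integral `A_γ^{(q)} g(z) = (∫_{D(z,γ)} g(w)^q dτ(w))^{1/q}`, valued in `ℝ≥0∞`. -/
def areaF {n : ℕ} (γ q : ℝ) (g : En n → ℝ) (z : En n) : ℝ≥0∞ :=
  (∫⁻ w in Dball z γ, ENNReal.ofReal (g w) ^ q ∂measTau n) ^ (1 / q)

/-- The smallest nonnegative integer `N` with `pN + α > -1`. -/
def Nmin (p α : ℝ) : ℕ := sInf {k : ℕ | p * k + α > -1}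

/-- The norm of the generalized Bergman space `A^p_α`,
`‖f‖_{p,α} = |f(0)| + (∫ (1-|z|²)^{pN} |R^N f|^p dv_α)^{1/p}` with `N = Nmin p α`. -/
def gapnorm (n : ℕ) (p α : ℝ) (f : En n → ℂ) : ℝ≥0∞ :=
  ENNReal.ofReal ‖f 0‖ +
    (∫⁻ z, ENNReal.ofReal ((1 - ‖z‖ ^ 2) ^ (p * Nmin p α) *
        ‖radIter (Nmin p α) f z‖ ^ p) ∂measA n α) ^ (1 / p)


instance vol_haar (n : ℕ) : (vol n).IsAddHaarMeasure := by unfold vol; infer_instance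
instance vol_sf (n : ℕ) : SigmaFinite (vol n) := by unfold vol; infer_instance

theorem aux_submean {f : ℂ → ℂ} (hf : AnalyticOnNhd ℂ f (Metric.closedBall 0 1)) {p : ℝ}
    (hp : 0 < p) : ‖f 0‖ ^ p ≤ Real.circleAverage (fun x => ‖f x‖ ^ p) 0 1 := by
  have hcont : ContinuousOn (fun x => ‖f x‖ ^ p) (Metric.sphere 0 1) :=
    ((hf.continuousOn.mono Metric.sphere_subset_closedBall).norm).rpow_const
      (fun x _ => Or.inr hp.le)
  by_cases h0 : f 0 = 0
  · rw [h0, norm_zero, Real.zero_rpow hp.ne']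
    apply Real.circleAverage_nonneg_of_nonneg
    intro x hx; positivity
  have hJ := AnalyticOnNhd.circleAverage_log_norm (R := 1) (c := 0) one_ne_zero
    (by simpa using hf) h0
  have hle : Real.log ‖f 0‖ ≤ Real.circleAverage (fun x => Real.log ‖f x‖) 0 1 := by
    rw [hJ]
    have : 0 ≤ ∑ᶠ u, (MeromorphicOn.divisor f (Metric.closedBall 0 |1|) u : ℝ) *
        Real.log (1 * ‖(0:ℂ) - u‖⁻¹) := by
      apply finsum_nonneg
      intro u
      by_cases hu : u ∈ Metric.closedBall (0:ℂ) |1|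
      · apply mul_nonneg
        · have : 0 ≤ MeromorphicOn.divisor f (Metric.closedBall 0 |1|) :=
            MeromorphicOn.AnalyticOnNhd.divisor_nonneg (by simpa using hf)
          exact_mod_cast this u
        · simp only [zero_sub, norm_neg, one_mul, Real.log_inv]
          have : ‖u‖ ≤ 1 := by simpa using hu
          have := Real.log_nonpos (norm_nonneg u) this
          linarith
      · rw [Function.locallyFinsuppWithin.apply_eq_zero_of_notMem _ hu]; simp
    linarith
  have hint : CircleIntegrable (fun x => Real.log ‖f x‖) 0 1 := by
    apply MeromorphicOn.circleIntegrable_log_norm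
    intro x hx
    exact (hf x (by simpa using (Metric.sphere_subset_closedBall hx))).meromorphicAt
  have hne : ∀ᶠ x in codiscreteWithin (Metric.sphere (0:ℂ) |1|), f x ≠ 0 := by
    have := hf.preimage_zero_mem_codiscreteWithin h0 (by simp)
      (Metric.isConnected_closedBall zero_le_one)
    have := codiscreteWithin_mono (U := Metric.closedBall (0:ℂ) 1)
      (U₁ := Metric.sphere (0:ℂ) |1|) (by simpa using Metric.sphere_subset_closedBall) this
    filter_upwards [this] with x hx using hx
  have hcongr : (fun x => Real.exp (p * Real.log ‖f x‖))
      =ᶠ[codiscreteWithin (Metric.sphere (0:ℂ) |1|)] (fun x => ‖f x‖ ^ p) := by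
    filter_upwards [hne] with x hx
    rw [Real.rpow_def_of_pos (norm_pos_iff.mpr hx), mul_comm]
  have hci : CircleIntegrable (fun x => ‖f x‖ ^ p) 0 1 :=
    ContinuousOn.circleIntegrable zero_le_one hcont
  have hci2 : CircleIntegrable (fun x => Real.exp (p * Real.log ‖f x‖)) 0 1 :=
    CircleIntegrable.congr_codiscreteWithin hcongr.symm hci
  rw [← Real.circleAverage_congr_codiscreteWithin hcongr one_ne_zero]
  have hconv : ConvexOn ℝ Set.univ (fun t : ℝ => Real.exp (p * t)) := by
    have := convexOn_exp.comp_linearMap (LinearMap.mulLeft ℝ p)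
    simpa [Function.comp_def] using this
  have key := hconv.map_set_average_le (μ := volume) (t := Set.uIoc 0 (2 * Real.pi))
    (f := fun θ => Real.log ‖f (circleMap 0 1 θ)‖) (by fun_prop) isClosed_univ
    (by simp [Set.uIoc_of_le Real.two_pi_pos.le, Real.pi_pos])
    (by rw [Set.uIoc_of_le Real.two_pi_pos.le, Real.volume_Ioc]; exact ENNReal.ofReal_ne_top) (by simp)
    (by rw [← intervalIntegrable_iff]; exact hint)
    (by rw [← intervalIntegrable_iff]; exact hci2)
  rw [Real.circleAverage_eq_intervalAverage] at hle ⊢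
  refine le_trans ?_ key
  rw [Real.rpow_def_of_pos (norm_pos_iff.mpr h0), mul_comm]
  apply Real.exp_le_exp.mpr
  exact mul_le_mul_of_nonneg_left hle hp.le

theorem aux_submean_l {f : ℂ → ℂ} (hf : AnalyticOnNhd ℂ f (Metric.closedBall 0 1)) {p : ℝ}
    (hp : 0 < p) : ENNReal.ofReal (2 * Real.pi) * ‖f 0‖ₑ ^ p ≤
      ∫⁻ θ in Set.Ioc 0 (2 * Real.pi), ‖f (circleMap 0 1 θ)‖ₑ ^ p := by
  have h := aux_submean hf hp
  have hcont : Continuous (fun θ => ‖f (circleMap 0 1 θ)‖ ^ p) := by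
    rw [← continuousOn_univ]
    refine ContinuousOn.rpow_const (ContinuousOn.norm ?_) (fun x _ => Or.inr hp.le)
    refine hf.continuousOn.comp (continuous_circleMap 0 1).continuousOn ?_
    intro x _; simp
  have e : ∀ θ, ‖f (circleMap 0 1 θ)‖ₑ ^ p = ENNReal.ofReal (‖f (circleMap 0 1 θ)‖ ^ p) := by
    intro θ
    rw [← ofReal_norm, ENNReal.ofReal_rpow_of_nonneg (norm_nonneg _) hp.le]
  simp_rw [e]
  rw [← ofReal_integral_eq_lintegral_ofReal, ← ofReal_norm,
    ENNReal.ofReal_rpow_of_nonneg (norm_nonneg _) hp.le, ← ENNReal.ofReal_mul (by positivity)]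
  · apply ENNReal.ofReal_le_ofReal
    rw [Real.circleAverage_def, intervalIntegral.integral_of_le Real.two_pi_pos.le,
      smul_eq_mul] at h
    have := mul_le_mul_of_nonneg_left h Real.two_pi_pos.le
    rwa [← mul_assoc, mul_inv_cancel₀ Real.two_pi_pos.ne', one_mul] at this
  · exact (hcont.integrableOn_Ioc)
  · exact Eventually.of_forall fun θ => by positivity

theorem map_lin {n : ℕ} (T : En n →ₗ[ℂ] En n) (hT : LinearMap.det T ≠ 0) :
    Measure.map T (vol n) = ENNReal.ofReal ((‖LinearMap.det T‖ ^ 2)⁻¹) • vol n := by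
  have h : LinearMap.det (T.restrictScalars ℝ) = ‖LinearMap.det T‖ ^ 2 := by
    rw [LinearMap.det_restrictScalars, Algebra.norm_complex_apply, Complex.normSq_eq_norm_sq]
  have := Measure.map_linearMap_addHaar_eq_smul_addHaar (vol n) (f := T.restrictScalars ℝ)
    (by rw [h]; simpa using hT)
  rw [h, abs_of_nonneg (by positivity)] at this
  exact this

theorem lint_lin {n : ℕ} (T : En n →ₗ[ℂ] En n) (hT : LinearMap.det T ≠ 0)
    (F : En n → ℝ≥0∞) (hF : Measurable F) :
    ENNReal.ofReal (‖LinearMap.det T‖ ^ 2) * ∫⁻ x, F (T x) ∂(vol n) = ∫⁻ x, F x ∂(vol n) := by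
  have hTm : Measurable T := (LinearMap.continuous_of_finiteDimensional T).measurable
  rw [← lintegral_map hF hTm, map_lin T hT, lintegral_smul_measure, smul_eq_mul, ← mul_assoc,
    ← ENNReal.ofReal_mul (by positivity), mul_inv_cancel₀ (by simpa using hT)]
  simp

theorem lint_rot {n : ℕ} (c : ℂ) (hc : ‖c‖ = 1) (F : En n → ℝ≥0∞) (hF : Measurable F) :
    ∫⁻ x, F (c • x) ∂(vol n) = ∫⁻ x, F x ∂(vol n) := by
  have := lint_lin (n := n) (c • LinearMap.id) (by
    rw [LinearMap.det_smul]; simp; intro h; simp [h] at hc) F hF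
  rw [LinearMap.det_smul] at this
  simpa [hc] using this

theorem meas_ind {n : ℕ} {h : En n → ℝ≥0∞} (h1 : ContinuousOn h (uball n)) :
    Measurable ((uball n).indicator h) := by
  have hopen : IsOpen (uball n) := Metric.isOpen_ball
  have := h1.measurable_piecewise (g := 0) continuousOn_const hopen.measurableSet
  rwa [Set.piecewise_eq_indicator] at this

/-- submean over a balanced linear image -/
theorem submean_lin {n : ℕ} {g : En n → ℂ} (hg : DifferentiableOn ℂ g (uball n)) {p : ℝ}
    (hp : 0 < p) (z : En n) (T : En n →ₗ[ℂ] En n) (hT : LinearMap.det T ≠ 0) (c : ℝ)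
    (D : Set (En n)) (hD : MeasurableSet D)
    (hS : ∀ x, ‖x‖ < c → z + T x ∈ D) (hDb : D ⊆ uball n) :
    ENNReal.ofReal (‖LinearMap.det T‖ ^ 2) * vol n (Metric.ball 0 c) * ‖g z‖ₑ ^ p ≤
      ∫⁻ x in D, ‖g x‖ₑ ^ p ∂(vol n) := by
  have hopen : IsOpen (uball n) := Metric.isOpen_ball
  set F : En n → ℝ≥0∞ := D.indicator (fun x => ‖g x‖ₑ ^ p) with hFdef
  have hF : Measurable F := by
    have h1 : ContinuousOn (fun x => ‖g x‖ₑ ^ p) (uball n) :=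
      (ENNReal.continuous_rpow_const).comp_continuousOn (hg.continuousOn.enorm)
    have h2 : Measurable ((uball n).indicator (fun x => ‖g x‖ₑ ^ p)) := meas_ind h1
    have : F = D.indicator ((uball n).indicator (fun x => ‖g x‖ₑ ^ p)) := by
      rw [Set.indicator_indicator, Set.inter_eq_left.mpr hDb]
    rw [this]; exact h2.indicator hD
  have hTm : Measurable T := (LinearMap.continuous_of_finiteDimensional T).measurable
  set B := Metric.ball (0 : En n) c
  have hB : MeasurableSet B := Metric.isOpen_ball.measurableSet
  set H : En n → ℝ≥0∞ := B.indicator (fun x => F (z + T x)) with hH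
  have hHm : Measurable H := (hF.comp (measurable_const.add hTm)).indicator hB
  have hcm : Measurable (fun q : ℝ × En n => circleMap 0 1 q.1 • q.2) :=
    Continuous.measurable (by fun_prop)
  have hbd : ∀ x ∈ B, ENNReal.ofReal (2 * Real.pi) * ‖g z‖ₑ ^ p ≤
      ∫⁻ θ in Set.Ioc 0 (2 * Real.pi), H (circleMap 0 1 θ • x) := by
    intro x hx
    have hx' : ‖x‖ < c := by simpa [B] using hx
    have hin : ∀ l : ℂ, ‖l‖ ≤ 1 → z + l • T x ∈ D := by
      intro l hl
      rw [← map_smul]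
      apply hS
      rw [norm_smul]
      nlinarith [norm_nonneg x]
    have han : AnalyticOnNhd ℂ (fun l : ℂ => g (z + l • T x)) (Metric.closedBall 0 1) := by
      have ho : IsOpen ((fun l : ℂ => z + l • T x) ⁻¹' uball n) :=
        hopen.preimage (by fun_prop)
      have hd : DifferentiableOn ℂ (fun l : ℂ => g (z + l • T x))
          ((fun l : ℂ => z + l • T x) ⁻¹' uball n) :=
        hg.comp (by fun_prop) (fun l hl => hl)
      exact (hd.analyticOnNhd ho).mono (fun l hl => hDb (hin l (by simpa using hl)))
    have := aux_submean_l han hp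
    simp only [zero_smul, add_zero] at this
    refine this.trans (le_of_eq ?_)
    apply lintegral_congr
    intro θ
    have h1 : circleMap 0 1 θ • x ∈ B := by
      simp [B, norm_smul]; exact hx'
    simp only [hH, Set.indicator_of_mem h1, hFdef, map_smul]
    rw [Set.indicator_of_mem (hin _ (by simp))]
  have h1 : ENNReal.ofReal (2 * Real.pi) * ‖g z‖ₑ ^ p * vol n B ≤
      ∫⁻ x, (∫⁻ θ in Set.Ioc 0 (2 * Real.pi), H (circleMap 0 1 θ • x)) ∂(vol n) := by
    rw [← setLIntegral_const]
    refine (setLIntegral_mono' hB hbd).trans (setLIntegral_le_lintegral _ _)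
  rw [lintegral_lintegral_swap] at h1
  swap
  · exact (hHm.comp (hcm.comp measurable_swap)).aemeasurable
  have h2 : ∀ θ : ℝ, ∫⁻ x, H (circleMap 0 1 θ • x) ∂(vol n) = ∫⁻ x, H x ∂(vol n) := fun θ =>
    lint_rot _ (by simp) H hHm
  simp_rw [h2] at h1
  rw [setLIntegral_const, Real.volume_Ioc, sub_zero, mul_assoc, mul_comm (∫⁻ _, _ ∂_),
    ENNReal.mul_le_mul_iff_right (by simp [Real.pi_pos]) ENNReal.ofReal_ne_top] at h1
  have h3 : ∫⁻ x, H x ∂(vol n) ≤ ∫⁻ x, F (z + T x) ∂(vol n) :=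
    lintegral_mono (Set.indicator_le_self _ _)
  have h4 := lint_lin T hT (fun x => F (z + x)) (hF.comp (measurable_const.add measurable_id))
  rw [lintegral_add_left_eq_self] at h4
  rw [← lintegral_indicator hD, ← h4, mul_assoc, mul_comm (vol n B)]
  exact mul_le_mul_right (h1.trans h3) _

def dd {n : ℕ} (z : En n) : ℝ := 1 - ‖z‖ ^ 2

def KD {n : ℕ} (M : ℝ) (z : En n) : Set (En n) :=
  {w | ‖w‖ < 1 ∧ ‖1 - inner ℂ z w‖ ^ 2 < M * (dd z * dd w)}

theorem dd_pos {n : ℕ} {z : En n} (hz : ‖z‖ < 1) : 0 < dd z := by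
  unfold dd; nlinarith [norm_nonneg z]

theorem dd_le_one {n : ℕ} (z : En n) : dd z ≤ 1 := by
  unfold dd; nlinarith [sq_nonneg ‖z‖]

theorem KD_symm {n : ℕ} {M : ℝ} {z w : En n} (hz : ‖z‖ < 1) (h : w ∈ KD M z) : z ∈ KD M w := by
  refine ⟨hz, ?_⟩
  have := h.2
  rw [← inner_conj_symm, mul_comm (dd w)]
  have e : (1 : ℂ) - (starRingEnd ℂ) (inner ℂ z w) = (starRingEnd ℂ) (1 - inner ℂ z w) := by simp
  rwa [e, RCLike.norm_conj]

theorem one_sub_inner_ge {n : ℕ} {z w : En n} (hz : ‖z‖ < 1) (hw : ‖w‖ < 1) :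
    dd z ≤ 2 * ‖1 - inner ℂ z w‖ := by
  have h1 : ‖(1:ℂ)‖ - ‖(inner ℂ z w : ℂ)‖ ≤ ‖1 - inner ℂ z w‖ := norm_sub_norm_le _ _
  have h2 := norm_inner_le_norm (𝕜 := ℂ) z w
  rw [norm_one] at h1
  unfold dd
  nlinarith [norm_nonneg z, norm_nonneg w]

theorem one_sub_inner_ge' {n : ℕ} {z w : En n} (hz : ‖z‖ < 1) (hw : ‖w‖ < 1) :
    dd w ≤ 2 * ‖1 - inner ℂ z w‖ := by
  have h1 : ‖(1:ℂ)‖ - ‖(inner ℂ z w : ℂ)‖ ≤ ‖1 - inner ℂ z w‖ := norm_sub_norm_le _ _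
  have h2 := norm_inner_le_norm (𝕜 := ℂ) z w
  rw [norm_one] at h1
  unfold dd
  nlinarith [norm_nonneg z, norm_nonneg w]

theorem KD_dd {n : ℕ} {M : ℝ} {z w : En n} (hz : ‖z‖ < 1) (h : w ∈ KD M z) :
    dd w ≤ 4 * M * dd z := by
  obtain ⟨hw, h⟩ := h
  have h1 := one_sub_inner_ge' hz hw
  have h2 := dd_pos hz
  have h3 := dd_pos hw
  have h4 : dd w ^ 2 ≤ 4 * M * dd z * dd w := by
    nlinarith [norm_nonneg (1 - inner ℂ z w)]
  nlinarith

theorem KD_dd' {n : ℕ} {M : ℝ} {z w : En n} (hz : ‖z‖ < 1) (h : w ∈ KD M z) :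
    dd z ≤ 4 * M * dd w := KD_dd h.1 (KD_symm hz h)

theorem KD_M_pos {n : ℕ} {M : ℝ} {z w : En n} (hz : ‖z‖ < 1) (h : w ∈ KD M z) : 0 < M := by
  obtain ⟨hw, h⟩ := h
  have h2 := mul_pos (dd_pos hz) (dd_pos hw)
  have := (sq_nonneg ‖1 - inner ℂ z w‖).trans_lt h
  exact pos_of_mul_pos_left this h2.le

theorem KD_inner {n : ℕ} {M : ℝ} {z w : En n} (hz : ‖z‖ < 1) (h : w ∈ KD M z) :
    ‖1 - inner ℂ z w‖ ≤ 2 * M * dd z := by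
  have hM := KD_M_pos hz h
  have h1 := KD_dd hz h
  have h2 := dd_pos hz
  apply le_of_sq_le_sq _ (by positivity)
  have : M * (dd z * dd w) ≤ M * (dd z * (4 * M * dd z)) := by gcongr
  nlinarith [h.2]

theorem normsub_sq {n : ℕ} {z w : En n} :
    ‖z - w‖ ^ 2 = 2 * (1 - inner ℂ z w : ℂ).re - dd z - dd w := by
  rw [norm_sub_sq (𝕜 := ℂ)]
  simp [dd]; ring

theorem normsub_sq_le {n : ℕ} {z w : En n} (hz : ‖z‖ < 1) (hw : ‖w‖ < 1) :
    ‖z - w‖ ^ 2 ≤ 2 * ‖1 - inner ℂ z w‖ := by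
  rw [normsub_sq]
  have := Complex.re_le_norm (1 - inner ℂ z w)
  linarith [dd_pos hz, dd_pos hw]

theorem quasi_tri {n : ℕ} {z w u : En n} (hz : ‖z‖ < 1) (hw : ‖w‖ < 1) (hu : ‖u‖ < 1) :
    ‖1 - inner ℂ z u‖ ≤ 4 * (‖1 - inner ℂ z w‖ + ‖1 - inner ℂ w u‖) := by
  have e : (1 : ℂ) - inner ℂ z u = (1 - inner ℂ z w) + (1 - inner ℂ w u) - (dd w : ℂ)
      + inner ℂ (z - w) (w - u) := by
    rw [inner_sub_left, inner_sub_right, inner_sub_right, inner_self_eq_norm_sq_to_K]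
    simp [dd]; ring
  set a := ‖1 - inner ℂ z w‖
  set b := ‖1 - inner ℂ w u‖
  have ha := normsub_sq_le hz hw
  have hb := normsub_sq_le hw hu
  have hd := one_sub_inner_ge hw hu
  have h1 := norm_inner_le_norm (𝕜 := ℂ) (z - w) (w - u)
  have h2 : ‖(dd w : ℂ)‖ = dd w := by
    rw [Complex.norm_real, Real.norm_of_nonneg (dd_pos hw).le]
  have h3 : ‖1 - inner ℂ z u‖ ≤ a + b + dd w + ‖z - w‖ * ‖w - u‖ := by
    rw [e]
    calc _ ≤ ‖(1 - inner ℂ z w) + (1 - inner ℂ w u) - (dd w : ℂ)‖ + ‖(inner ℂ (z - w) (w - u) : ℂ)‖ :=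
          norm_add_le _ _
      _ ≤ ‖(1 - inner ℂ z w) + (1 - inner ℂ w u)‖ + ‖(dd w : ℂ)‖ + ‖z - w‖ * ‖w - u‖ := by
          gcongr; exact norm_sub_le _ _
      _ ≤ _ := by rw [h2]; gcongr; exact norm_add_le _ _
  have ha0 : 0 ≤ a := norm_nonneg _
  have hb0 : 0 ≤ b := norm_nonneg _
  nlinarith [sq_nonneg (‖z - w‖ - ‖w - u‖)]

theorem KD_trans (n : ℕ) (M M' : ℝ) : ∃ M'' : ℝ, ∀ z w u : En n, ‖z‖ < 1 → w ∈ KD M z →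
    u ∈ KD M' w → u ∈ KD M'' z := by
  refine ⟨(8 * M + 32 * M * M') ^ 2 * (16 * M * M') + 1, fun z w u hz hw hu => ?_⟩
  have hM := KD_M_pos hz hw
  have hM' := KD_M_pos hw.1 hu
  refine ⟨hu.1, ?_⟩
  have hdz := dd_pos hz
  have hdu := dd_pos hu.1
  have h1 := quasi_tri hz hw.1 hu.1
  have h2 := KD_inner hz hw
  have h3 := KD_inner hw.1 hu
  have h4 := KD_dd hz hw
  have h5 := KD_dd' hz hw
  have h6 := KD_dd' hw.1 hu
  have h7 : ‖1 - inner ℂ w u‖ ≤ 2 * M' * (4 * M * dd z) := h3.trans (by gcongr)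
  have h8 : ‖1 - inner ℂ z u‖ ≤ (8 * M + 32 * M * M') * dd z := by nlinarith
  have h9 : dd z ≤ (16 * M * M') * dd u := by
    have : 4 * M * dd w ≤ 4 * M * (4 * M' * dd u) := by gcongr
    linarith
  have h10 : ‖1 - inner ℂ z u‖ ^ 2 ≤ ((8 * M + 32 * M * M') * dd z) ^ 2 := by gcongr
  have h11 : (8 * M + 32 * M * M') ^ 2 * dd z * dd z ≤
      (8 * M + 32 * M * M') ^ 2 * dd z * ((16 * M * M') * dd u) := by gcongr
  have := mul_pos hdz hdu
  nlinarith

def Tz {n : ℕ} (z : En n) : En n →ₗ[ℂ] En n :=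
  ((Real.sqrt (dd z) : ℝ) : ℂ) • LinearMap.transvection
    ((-(1 + (Real.sqrt (dd z) : ℂ))⁻¹ : ℂ) • (innerSL ℂ z).toLinearMap) z

theorem Tz_apply {n : ℕ} (z x : En n) : Tz z x = ((Real.sqrt (dd z) : ℝ) : ℂ) •
    (x + (-(1 + (Real.sqrt (dd z) : ℂ))⁻¹ * inner ℂ z x) • z) := by
  simp [Tz, LinearMap.transvection]

theorem normz_sq {n : ℕ} {z : En n} (hz : ‖z‖ < 1) : ‖z‖ ^ 2 = 1 - (Real.sqrt (dd z)) ^ 2 := by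
  rw [Real.sq_sqrt (dd_pos hz).le]; simp [dd]

theorem one_add_sqrt_ne {n : ℕ} (z : En n) : (1 + (Real.sqrt (dd z) : ℂ)) ≠ 0 := by
  have : 0 < 1 + Real.sqrt (dd z) := by positivity
  exact_mod_cast this.ne'

theorem coef_id {n : ℕ} {z : En n} (hz : ‖z‖ < 1) :
    1 + -(1 + (Real.sqrt (dd z) : ℂ))⁻¹ * inner ℂ z z = (Real.sqrt (dd z) : ℂ) := by
  have := one_add_sqrt_ne z
  have h := normz_sq hz
  rw [inner_self_eq_norm_sq_to_K]
  have h' : ((‖z‖ : ℂ)) ^ 2 = 1 - (Real.sqrt (dd z) : ℂ) ^ 2 := by exact_mod_cast h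
  simp only [Complex.coe_algebraMap]
  rw [h']
  field_simp
  ring

theorem Tz_det {n : ℕ} {z : En n} (hz : ‖z‖ < 1) :
    LinearMap.det (Tz z) = (Real.sqrt (dd z) : ℂ) ^ (n + 1) := by
  rw [Tz, LinearMap.det_smul, LinearMap.transvection.det]
  have : (((-(1 + (Real.sqrt (dd z) : ℂ))⁻¹ : ℂ) • (innerSL ℂ z).toLinearMap) : Module.Dual ℂ (En n)) z
    = -(1 + (Real.sqrt (dd z) : ℂ))⁻¹ * inner ℂ z z := by simp
  rw [this, coef_id hz]
  simp [pow_succ]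

theorem Tz_det_norm {n : ℕ} {z : En n} (hz : ‖z‖ < 1) :
    ‖LinearMap.det (Tz z)‖ ^ 2 = dd z ^ (n + 1) := by
  rw [Tz_det hz, norm_pow, Complex.norm_real, Real.norm_of_nonneg (Real.sqrt_nonneg _), ← pow_mul,
    mul_comm, pow_mul, Real.sq_sqrt (dd_pos hz).le]

theorem Tz_det_ne {n : ℕ} {z : En n} (hz : ‖z‖ < 1) : LinearMap.det (Tz z) ≠ 0 := by
  rw [Tz_det hz]
  have := Real.sqrt_pos.mpr (dd_pos hz)
  exact pow_ne_zero _ (by exact_mod_cast this.ne')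

theorem Tz_inner {n : ℕ} {z : En n} (hz : ‖z‖ < 1) (x : En n) :
    inner ℂ z (Tz z x) = (dd z : ℂ) * inner ℂ z x := by
  rw [Tz_apply, inner_smul_right, inner_add_right, inner_smul_right]
  have h := coef_id hz
  have h2 : (dd z : ℂ) = (Real.sqrt (dd z) : ℂ) * (Real.sqrt (dd z) : ℂ) := by
    rw [← Complex.ofReal_mul, Real.mul_self_sqrt (dd_pos hz).le]
  rw [h2]
  linear_combination ((Real.sqrt (dd z) : ℂ)) * inner ℂ z x * h

theorem norm_coef {n : ℕ} (z : En n) : ‖(1 + (Real.sqrt (dd z) : ℂ))⁻¹‖ ≤ 1 := by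
  rw [norm_inv]
  have : (1 + (Real.sqrt (dd z) : ℂ)) = ((1 + Real.sqrt (dd z) : ℝ) : ℂ) := by push_cast; ring
  rw [this, Complex.norm_real, Real.norm_of_nonneg (by positivity)]
  apply inv_le_one_of_one_le₀
  linarith [Real.sqrt_nonneg (dd z)]

theorem Tz_norm {n : ℕ} {z : En n} (hz : ‖z‖ < 1) (x : En n) :
    ‖Tz z x‖ ^ 2 ≤ 4 * dd z * ‖x‖ ^ 2 := by
  have h1 : ‖x + (-(1 + (Real.sqrt (dd z) : ℂ))⁻¹ * inner ℂ z x) • z‖ ≤ 2 * ‖x‖ := by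
    refine (norm_add_le _ _).trans ?_
    rw [norm_smul, norm_mul, norm_neg]
    have h2 := norm_inner_le_norm (𝕜 := ℂ) z x
    have h3 : ‖(1 + (Real.sqrt (dd z) : ℂ))⁻¹‖ * ‖(inner ℂ z x : ℂ)‖ * ‖z‖ ≤ 1 * (‖z‖ * ‖x‖) * 1 := by
      gcongr
      exact norm_coef z
    nlinarith [norm_nonneg x]
  rw [Tz_apply, norm_smul, mul_pow, Complex.norm_real, Real.norm_of_nonneg (Real.sqrt_nonneg _),
    Real.sq_sqrt (dd_pos hz).le]
  have h0 := (dd_pos hz).le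
  calc _ ≤ dd z * (2 * ‖x‖) ^ 2 := by gcongr
    _ = _ := by ring

theorem sub_in (n : ℕ) {M : ℝ} (hM : 1 < M) : ∃ c : ℝ, 0 < c ∧ ∀ z : En n, ‖z‖ < 1 →
    ∀ x : En n, ‖x‖ < c → z + Tz z x ∈ KD M z := by
  refine ⟨(M - 1) / (2 * (3 + 6 * M)), by
    apply div_pos <;> linarith, fun z hz x hx => ?_⟩
  set c := (M - 1) / (2 * (3 + 6 * M)) with hc
  have hc' : c * (2 * (3 + 6 * M)) = M - 1 := by rw [hc]; field_simp
  have hc0 : 0 < c := by rw [hc]; apply div_pos <;> linarith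
  have hc1 : c ≤ 1 / 12 := by nlinarith
  have hd := dd_pos hz
  have hin : ‖(inner ℂ z x : ℂ)‖ ≤ ‖x‖ := by
    have := norm_inner_le_norm (𝕜 := ℂ) z x
    nlinarith [norm_nonneg x]
  have e1 : (1 : ℂ) - inner ℂ z (z + Tz z x) = (dd z : ℂ) * (1 - inner ℂ z x) := by
    rw [inner_add_right, Tz_inner hz, inner_self_eq_norm_sq_to_K]
    simp [dd]; ring
  have e2 : dd (z + Tz z x) = dd z - 2 * (dd z * (inner ℂ z x : ℂ).re) - ‖Tz z x‖ ^ 2 := by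
    have e3 : RCLike.re ((dd z : ℂ) * inner ℂ z x) = dd z * (inner ℂ z x : ℂ).re :=
      Complex.re_ofReal_mul _ _
    have e4 : dd (z + Tz z x) = 1 - ‖z + Tz z x‖ ^ 2 := rfl
    rw [e4, norm_add_sq (𝕜 := ℂ), Tz_inner hz, e3]
    have e5 : dd z = 1 - ‖z‖ ^ 2 := rfl
    linear_combination - e5
  have hT := Tz_norm hz x
  have hre := Complex.re_le_norm (inner ℂ z x : ℂ)
  have hx0 := norm_nonneg x
  have hlow : dd z * (1 - 6 * c) ≤ dd (z + Tz z x) := by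
    rw [e2]
    have : dd z * (inner ℂ z x : ℂ).re ≤ dd z * c := by
      apply mul_le_mul_of_nonneg_left _ hd.le; linarith
    have : 4 * dd z * ‖x‖ ^ 2 ≤ 4 * dd z * c := by
      apply mul_le_mul_of_nonneg_left _ (by positivity); nlinarith
    linarith
  have hpos : 0 < dd (z + Tz z x) := lt_of_lt_of_le (by apply mul_pos hd; linarith) hlow
  refine ⟨?_, ?_⟩
  · unfold dd at hpos
    nlinarith [norm_nonneg (z + Tz z x)]
  · rw [e1, norm_mul, Complex.norm_real, Real.norm_of_nonneg hd.le, mul_pow]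
    have h1 : ‖1 - (inner ℂ z x : ℂ)‖ ≤ 1 + c := by
      refine (norm_sub_le _ _).trans ?_
      rw [norm_one]; linarith
    have h2 : ‖1 - (inner ℂ z x : ℂ)‖ ^ 2 ≤ (1 + c) ^ 2 := by gcongr
    have h3 : (1 + c) ^ 2 < M * (1 - 6 * c) := by nlinarith
    calc dd z ^ 2 * ‖1 - (inner ℂ z x : ℂ)‖ ^ 2 ≤ dd z ^ 2 * (1 + c) ^ 2 := by gcongr
      _ < dd z ^ 2 * (M * (1 - 6 * c)) := by gcongr
      _ = M * (dd z * (dd z * (1 - 6 * c))) := by ring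
      _ ≤ _ := by gcongr

theorem sup_in (n : ℕ) (M : ℝ) : ∃ C : ℝ, 0 < C ∧ ∀ z : En n, ‖z‖ < 1 →
    ∀ w ∈ KD M z, ∃ x : En n, ‖x‖ < C ∧ w = z + Tz z x := by
  refine ⟨4 * |M| + 3, by positivity, fun z hz w hw => ?_⟩
  have hM := KD_M_pos hz hw
  rw [abs_of_pos hM]
  have hd := dd_pos hz
  set s := Real.sqrt (dd z) with hs
  have hs0 : 0 < s := Real.sqrt_pos.mpr hd
  have hsq : s ^ 2 = dd z := Real.sq_sqrt hd.le
  have hsC : (s : ℂ) ≠ 0 := by exact_mod_cast hs0.ne'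
  have h1s := one_add_sqrt_ne z
  rw [← hs] at h1s
  refine ⟨(s : ℂ)⁻¹ • ((w - z) + (inner ℂ z (w - z) * ((s : ℂ) * (1 + (s:ℂ)))⁻¹) • z), ?_, ?_⟩
  · have h1 : ‖w - z‖ ≤ (M + 1) * (2 * s) := by
      apply le_of_sq_le_sq _ (by positivity)
      have := normsub_sq_le hz hw.1
      have h2 := KD_inner hz hw
      rw [norm_sub_rev]
      have h5 : 0 ≤ (M ^ 2 + M + 1) * dd z := by positivity
      have h6 : ((M + 1) * (2 * s)) ^ 2 = 4 * (M + 1) ^ 2 * dd z := by rw [← hsq]; ring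
      rw [h6]
      linarith
    have h2 : ‖(inner ℂ z (w - z) : ℂ)‖ ≤ (2 * M + 1) * s ^ 2 := by
      have e : (inner ℂ z (w - z) : ℂ) = (dd z : ℂ) - (1 - inner ℂ z w) := by
        rw [inner_sub_right, inner_self_eq_norm_sq_to_K]; simp [dd]
      rw [e]
      refine (norm_sub_le _ _).trans ?_
      rw [Complex.norm_real, Real.norm_of_nonneg hd.le, hsq]
      linarith [KD_inner hz hw]
    have h3 : ‖((s : ℂ) * (1 + (s:ℂ)))⁻¹‖ ≤ s⁻¹ := by
      rw [mul_inv, norm_mul]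
      have := norm_coef z
      rw [← hs] at this
      rw [norm_inv, Complex.norm_real, Real.norm_of_nonneg hs0.le]
      have : 0 < s⁻¹ := by positivity
      nlinarith
    rw [norm_smul, norm_inv, Complex.norm_real, Real.norm_of_nonneg hs0.le]
    rw [inv_mul_lt_iff₀ hs0]
    refine (norm_add_le _ _).trans_lt ?_
    rw [norm_smul, norm_mul]
    have h4 : ‖(inner ℂ z (w - z) : ℂ)‖ * ‖((s : ℂ) * (1 + (s:ℂ)))⁻¹‖ * ‖z‖ <
      ((2 * M + 1) * s ^ 2) * s⁻¹ * 1 := by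
      apply mul_lt_mul_of_le_of_lt_of_nonneg_of_pos _ hz (by positivity) (by positivity)
      gcongr
    have h5 : ((2 * M + 1) * s ^ 2) * s⁻¹ * 1 = (2 * M + 1) * s := by field_simp
    rw [h5] at h4
    nlinarith
  · rw [Tz_apply, ← hs]
    have hcid := coef_id hz
    rw [← hs] at hcid
    have key : ∀ h : En n, (s : ℂ) • ((s : ℂ)⁻¹ • (h + (inner ℂ z h * ((s : ℂ) * (1 + (s:ℂ)))⁻¹) • z) +
        (-(1 + (s:ℂ))⁻¹ * inner ℂ z ((s : ℂ)⁻¹ • (h + (inner ℂ z h * ((s : ℂ) * (1 + (s:ℂ)))⁻¹) • z))) • z) = h := by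
      intro h
      rw [inner_smul_right, inner_add_right, inner_smul_right]
      have hzz : (inner ℂ z z : ℂ) = (1 - (s : ℂ)) * (1 + s) := by
        field_simp at hcid
        linear_combination -hcid
      rw [hzz]
      have : ∀ a b : ℂ, (s : ℂ) • ((s : ℂ)⁻¹ • (h + a • z) + b • z) = h + (a + s * b) • z := by
        intro a b
        rw [smul_add, smul_smul, mul_inv_cancel₀ hsC, one_smul, smul_smul, add_assoc, ← add_smul]
      rw [this]
      have h0 : inner ℂ z h * ((s : ℂ) * (1 + (s:ℂ)))⁻¹ + s * (-(1 + (s:ℂ))⁻¹ * ((s : ℂ)⁻¹ * (inner ℂ z h + inner ℂ z h * ((s : ℂ) * (1 + (s:ℂ)))⁻¹ * ((1 - (s : ℂ)) * (1 + s))))) = 0 := by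
        field_simp
        ring
      rw [h0, zero_smul, add_zero]
    rw [key]
    abel

theorem KD_open {n : ℕ} (M : ℝ) (z : En n) : IsOpen (KD M z) := by
  have h1 : IsOpen {w : En n | ‖w‖ < 1} := isOpen_lt (by fun_prop) (by fun_prop)
  have h2 : IsOpen {w : En n | ‖1 - inner ℂ z w‖ ^ 2 < M * (dd z * dd w)} := by
    apply isOpen_lt
    · exact ((continuous_const.sub (innerSL ℂ z).continuous).norm.pow 2)
    · unfold dd; fun_prop
  exact h1.inter h2

theorem KD_sub {n : ℕ} (M : ℝ) (z : En n) : KD M z ⊆ uball n := by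
  intro w hw; simpa [uball] using hw.1

theorem vol_KD (n : ℕ) (M : ℝ) : ∃ C : ℝ≥0∞, C ≠ ⊤ ∧ ∀ z : En n, ‖z‖ < 1 →
    vol n (KD M z) ≤ C * ENNReal.ofReal (dd z ^ (n + 1)) := by
  obtain ⟨C, hC, h⟩ := sup_in n M
  refine ⟨vol n (Metric.ball 0 C), measure_ball_lt_top.ne, fun z hz => ?_⟩
  have hsub : KD M z ⊆ (fun y => z + y) '' (Tz z '' (Metric.ball 0 C)) := by
    intro w hw
    obtain ⟨x, hx, e⟩ := h z hz w hw
    exact ⟨_, ⟨x, by simpa using hx, rfl⟩, e.symm⟩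
  refine (measure_mono hsub).trans ?_
  rw [Set.image_add_left, measure_preimage_add]
  have := Measure.addHaar_image_linearMap (vol n) ((Tz z).restrictScalars ℝ) (Metric.ball 0 C)
  rw [LinearMap.det_restrictScalars, Algebra.norm_complex_apply, Complex.normSq_eq_norm_sq,
    Tz_det_norm hz, abs_of_pos (pow_pos (dd_pos hz) _), mul_comm] at this
  exact this.le

def Wt {n : ℕ} (s : ℝ) (z : En n) : ℝ≥0∞ := ENNReal.ofReal (dd z ^ s)

theorem Wt_meas {n : ℕ} (s : ℝ) : Measurable (Wt (n := n) s) := by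
  unfold Wt dd
  fun_prop

theorem Wt_add {n : ℕ} {z : En n} (hz : ‖z‖ < 1) (s t : ℝ) : Wt (s + t) z = Wt s z * Wt t z := by
  unfold Wt
  rw [Real.rpow_add (dd_pos hz), ENNReal.ofReal_mul (Real.rpow_nonneg (dd_pos hz).le _)]

theorem Wt_zero {n : ℕ} (z : En n) : Wt 0 z = 1 := by simp [Wt]

theorem Wt_ne_top {n : ℕ} (s : ℝ) (z : En n) : Wt s z ≠ ⊤ := ENNReal.ofReal_ne_top

theorem Wt_ne_zero {n : ℕ} {z : En n} (hz : ‖z‖ < 1) (s : ℝ) : Wt s z ≠ 0 := by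
  unfold Wt
  simpa using Real.rpow_pos_of_pos (dd_pos hz) s

theorem Wt_neg_mul {n : ℕ} {z : En n} (hz : ‖z‖ < 1) (s : ℝ) : Wt (-s) z * Wt s z = 1 := by
  rw [← Wt_add hz, neg_add_cancel, Wt_zero]

theorem Wt_rpow {n : ℕ} {z : En n} (hz : ‖z‖ < 1) (s p : ℝ) : Wt s z ^ p = Wt (s * p) z := by
  unfold Wt
  rw [ENNReal.ofReal_rpow_of_pos (Real.rpow_pos_of_pos (dd_pos hz) _),
    Real.rpow_mul (dd_pos hz).le]

theorem rpow_cmp {a b K : ℝ} (ha : 0 < a) (hb : 0 < b) (h1 : a ≤ K * b) (h2 : b ≤ K * a) (s : ℝ) :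
    a ^ s ≤ K ^ |s| * b ^ s := by
  have hK : 0 < K := pos_of_mul_pos_left (ha.trans_le h1) hb.le
  rcases le_total 0 s with hs | hs
  · rw [abs_of_nonneg hs, ← Real.mul_rpow hK.le hb.le]
    exact Real.rpow_le_rpow ha.le h1 hs
  · rw [abs_of_nonpos hs]
    have : b / K ≤ a := by rw [div_le_iff₀ hK]; linarith
    have := Real.rpow_le_rpow_of_nonpos (div_pos hb hK) this hs
    rwa [Real.div_rpow hb.le hK.le, div_eq_mul_inv, ← Real.rpow_neg hK.le, mul_comm] at this

theorem Wt_cmp {n : ℕ} {M : ℝ} {z w : En n} (hz : ‖z‖ < 1) (h : w ∈ KD M z) (s : ℝ) :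
    Wt s w ≤ ENNReal.ofReal ((4 * M) ^ |s|) * Wt s z := by
  unfold Wt
  have hM := KD_M_pos hz h
  rw [← ENNReal.ofReal_mul (by positivity)]
  apply ENNReal.ofReal_le_ofReal
  exact rpow_cmp (dd_pos h.1) (dd_pos hz) (KD_dd hz h) (KD_dd' hz h) s

theorem Wt_cmp' {n : ℕ} {M : ℝ} {z w : En n} (hz : ‖z‖ < 1) (h : w ∈ KD M z) (s : ℝ) :
    Wt s z ≤ ENNReal.ofReal ((4 * M) ^ |s|) * Wt s w := Wt_cmp h.1 (KD_symm hz h) s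

theorem uball_meas (n : ℕ) : MeasurableSet (uball n) := Metric.isOpen_ball.measurableSet

theorem mem_uball {n : ℕ} {z : En n} : z ∈ uball n ↔ ‖z‖ < 1 := by simp [uball]

theorem lint_tau {n : ℕ} (F : En n → ℝ≥0∞) :
    ∫⁻ z, F z ∂measTau n = ∫⁻ z in uball n, Wt (-((n : ℝ) + 1)) z * F z ∂vol n := by
  unfold measTau
  rw [lintegral_withDensity_eq_lintegral_mul_non_measurable]
  · rfl
  · exact Wt_meas (-((n : ℝ) + 1))
  · exact Eventually.of_forall fun z => ENNReal.ofReal_lt_top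

theorem lint_A {n : ℕ} (α : ℝ) (F : En n → ℝ≥0∞) :
    ∫⁻ z, F z ∂measA n α = ENNReal.ofReal (cnorm n α) *
      ∫⁻ z in uball n, Wt α z * F z ∂vol n := by
  unfold measA
  rw [lintegral_withDensity_eq_lintegral_mul_non_measurable, ← lintegral_const_mul']
  · apply setLIntegral_congr_fun (uball_meas n)
    intro z hz
    simp only [Pi.mul_apply]
    change ENNReal.ofReal (cnorm n α * dd z ^ α) * F z = _
    rw [ENNReal.ofReal_mul' (Real.rpow_nonneg (dd_pos (mem_uball.mp hz)).le _), mul_assoc]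
    rfl
  · exact ENNReal.ofReal_ne_top
  · fun_prop
  · exact Eventually.of_forall fun z => ENNReal.ofReal_lt_top

/-- vol integrals in terms of tau -/
theorem lint_vol {n : ℕ} (F : En n → ℝ≥0∞) :
    ∫⁻ z in uball n, F z ∂vol n = ∫⁻ z, Wt ((n : ℝ) + 1) z * F z ∂measTau n := by
  rw [lint_tau]
  apply setLIntegral_congr_fun (uball_meas n)
  intro z hz
  simp only
  rw [← mul_assoc, Wt_neg_mul (mem_uball.mp hz), one_mul]

theorem ae_tau {n : ℕ} : ∀ᵐ z ∂measTau n, ‖z‖ < 1 := by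
  unfold measTau
  apply (withDensity_absolutelyContinuous _ _).ae_le
  filter_upwards [ae_restrict_mem (uball_meas n)] with z hz using mem_uball.mp hz

instance tau_sf (n : ℕ) : SFinite (measTau n) := by unfold measTau; infer_instance

theorem KD_meas {n : ℕ} (M : ℝ) (z : En n) : MeasurableSet (KD M z) := (KD_open M z).measurableSet

/-- restricted integrals -/
theorem lint_tau_set {n : ℕ} (M : ℝ) (z : En n) (F : En n → ℝ≥0∞) :
    ∫⁻ w in KD M z, F w ∂measTau n = ∫⁻ w in KD M z, Wt (-((n : ℝ) + 1)) w * F w ∂vol n := by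
  rw [← lintegral_indicator (KD_meas M z), lint_tau]
  have : ∀ w, Wt (-((n : ℝ) + 1)) w * (KD M z).indicator F w =
      (KD M z).indicator (fun w => Wt (-((n : ℝ) + 1)) w * F w) w := by
    intro w; by_cases h : w ∈ KD M z <;> simp [h]
  simp_rw [this]
  rw [setLIntegral_indicator (KD_meas M z), Set.inter_eq_left.mpr (KD_sub M z)]

theorem tau_KD (n : ℕ) (M : ℝ) : ∃ C : ℝ≥0∞, C ≠ ⊤ ∧ ∀ z : En n, ‖z‖ < 1 →
    measTau n (KD M z) ≤ C := by
  obtain ⟨C, hC, h⟩ := vol_KD n M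
  refine ⟨ENNReal.ofReal ((4 * M) ^ |(-((n : ℝ) + 1))|) * C,
    ENNReal.mul_ne_top ENNReal.ofReal_ne_top hC, fun z hz => ?_⟩
  have e : measTau n (KD M z) = ∫⁻ w in KD M z, 1 ∂measTau n := by simp
  rw [e, lint_tau_set]
  have h1 : ∫⁻ w in KD M z, Wt (-((n : ℝ) + 1)) w * 1 ∂vol n ≤
      ∫⁻ w in KD M z, ENNReal.ofReal ((4 * M) ^ |(-((n : ℝ) + 1))|) * Wt (-((n : ℝ) + 1)) z ∂vol n := by
    apply setLIntegral_mono' (KD_meas M z)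
    intro w hw
    rw [mul_one]
    exact Wt_cmp hz hw _
  refine h1.trans ?_
  rw [setLIntegral_const]
  have h2 : ENNReal.ofReal (dd z ^ (n + 1)) = Wt ((n : ℝ) + 1) z := by
    unfold Wt
    congr 1
    exact_mod_cast (Real.rpow_natCast (dd z) (n + 1)).symm
  have h3 := h z hz
  rw [h2] at h3
  calc _ ≤ ENNReal.ofReal ((4 * M) ^ |(-((n : ℝ) + 1))|) * Wt (-((n : ℝ) + 1)) z *
        (C * Wt ((n : ℝ) + 1) z) := by gcongr
    _ = ENNReal.ofReal ((4 * M) ^ |(-((n : ℝ) + 1))|) * C *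
        (Wt (-((n : ℝ) + 1)) z * Wt ((n : ℝ) + 1) z) := by ring
    _ = _ := by rw [Wt_neg_mul hz, mul_one]

theorem fubini_KD (n : ℕ) (M s : ℝ) : ∃ C : ℝ≥0∞, C ≠ ⊤ ∧ ∀ F : En n → ℝ≥0∞, Measurable F →
    ∫⁻ z, Wt s z * (∫⁻ w in KD M z, F w ∂measTau n) ∂measTau n ≤
      C * ∫⁻ w, Wt s w * F w ∂measTau n := by
  obtain ⟨C, hC, h⟩ := tau_KD n M
  set K := ENNReal.ofReal ((4 * M) ^ |s|) with hK
  refine ⟨K * C, ENNReal.mul_ne_top ENNReal.ofReal_ne_top hC, fun F hF => ?_⟩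
  set S : Set (En n × En n) := {q | ‖q.1‖ < 1 ∧ q.2 ∈ KD M q.1} with hS
  have hSm : MeasurableSet S := by
    apply IsOpen.measurableSet
    have h1 : IsOpen {q : En n × En n | ‖q.1‖ < 1} := isOpen_lt (by fun_prop) (by fun_prop)
    have h2 : IsOpen {q : En n × En n | ‖q.2‖ < 1} := isOpen_lt (by fun_prop) (by fun_prop)
    have h3 : IsOpen {q : En n × En n | ‖1 - inner ℂ q.1 q.2‖ ^ 2 < M * (dd q.1 * dd q.2)} := by
      apply isOpen_lt
      · exact ((continuous_const.sub (continuous_fst.inner continuous_snd)).norm.pow 2)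
      · unfold dd; fun_prop
    exact h1.inter (h2.inter h3)
  have e1 : ∫⁻ z, Wt s z * (∫⁻ w in KD M z, F w ∂measTau n) ∂measTau n =
      ∫⁻ z, (∫⁻ w, S.indicator (fun q => Wt s q.1 * F q.2) (z, w) ∂measTau n) ∂measTau n := by
    apply lintegral_congr_ae
    filter_upwards [ae_tau] with z hz
    rw [← lintegral_const_mul' _ _ (Wt_ne_top s z), ← lintegral_indicator (KD_meas M z)]
    apply lintegral_congr
    intro w
    by_cases hw : w ∈ KD M z
    · rw [Set.indicator_of_mem hw, Set.indicator_of_mem (show (z, w) ∈ S from ⟨hz, hw⟩)]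
    · rw [Set.indicator_of_notMem hw, Set.indicator_of_notMem (fun h : (z, w) ∈ S => hw h.2)]
  rw [e1, lintegral_lintegral_swap]
  swap
  · exact ((((Wt_meas s).comp measurable_fst).mul (hF.comp measurable_snd)).indicator hSm).aemeasurable
  rw [← lintegral_const_mul' _ _ (ENNReal.mul_ne_top ENNReal.ofReal_ne_top hC)]
  apply lintegral_mono_ae
  filter_upwards [ae_tau] with w hw
  have h1 : ∀ z, S.indicator (fun q => Wt s q.1 * F q.2) (z, w) ≤
      (KD M w).indicator (fun _ => K * Wt s w * F w) z := by
    intro z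
    by_cases hz : (z, w) ∈ S
    · have hz1 : ‖z‖ < 1 := hz.1
      have hz2 : w ∈ KD M z := hz.2
      rw [Set.indicator_of_mem hz, Set.indicator_of_mem (KD_symm hz1 hz2)]
      exact mul_le_mul_left (Wt_cmp' hz1 hz2 s) _
    · rw [Set.indicator_of_notMem hz]; exact zero_le
  refine (lintegral_mono h1).trans ?_
  rw [lintegral_indicator (KD_meas M w), setLIntegral_const]
  calc K * Wt s w * F w * measTau n (KD M w) ≤ K * Wt s w * F w * C := by gcongr; exact h w hw
    _ = _ := by ring

theorem submean_KD (n : ℕ) {M : ℝ} (hM : 1 < M) : ∃ C : ℝ≥0∞, C ≠ ⊤ ∧ ∀ p : ℝ, 0 < p →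
    ∀ g : En n → ℂ, DifferentiableOn ℂ g (uball n) → ∀ z : En n, ‖z‖ < 1 →
    ‖g z‖ₑ ^ p ≤ C * ∫⁻ w in KD M z, ‖g w‖ₑ ^ p ∂measTau n := by
  obtain ⟨c, hc, h⟩ := sub_in n hM
  set K := ENNReal.ofReal ((4 * M) ^ |(n : ℝ) + 1|) with hK
  have hv0 : vol n (Metric.ball 0 c) ≠ 0 := (Metric.measure_ball_pos _ _ hc).ne'
  have hv1 : vol n (Metric.ball 0 c) ≠ ⊤ := measure_ball_lt_top.ne
  refine ⟨(vol n (Metric.ball 0 c))⁻¹ * K, ENNReal.mul_ne_top (by simpa using hv0)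
    ENNReal.ofReal_ne_top, fun p hp g hg z hz => ?_⟩
  have h1 := submean_lin hg hp z (Tz z) (Tz_det_ne hz) c (KD M z) (KD_meas M z) (h z hz) (KD_sub M z)
  have h2 : ENNReal.ofReal (‖LinearMap.det (Tz z)‖ ^ 2) = Wt ((n : ℝ) + 1) z := by
    unfold Wt
    rw [Tz_det_norm hz]
    congr 1
    exact_mod_cast (Real.rpow_natCast (dd z) (n + 1)).symm
  rw [h2] at h1
  have h3 : ∫⁻ w in KD M z, ‖g w‖ₑ ^ p ∂vol n ≤
      K * Wt ((n : ℝ) + 1) z * ∫⁻ w in KD M z, ‖g w‖ₑ ^ p ∂measTau n := by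
    rw [lint_tau_set, ← lintegral_const_mul' _ _ (ENNReal.mul_ne_top ENNReal.ofReal_ne_top (Wt_ne_top _ _))]
    apply setLIntegral_mono' (KD_meas M z)
    intro w hw
    have h4 := Wt_cmp hz hw ((n : ℝ) + 1)
    calc ‖g w‖ₑ ^ p = Wt ((n : ℝ) + 1) w * (Wt (-((n : ℝ) + 1)) w * ‖g w‖ₑ ^ p) := by
          rw [← mul_assoc, mul_comm (Wt _ w), Wt_neg_mul hw.1, one_mul]
      _ ≤ _ := by gcongr
  have h5 := h1.trans h3
  set I := ∫⁻ w in KD M z, ‖g w‖ₑ ^ p ∂measTau n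
  have h6 : Wt ((n : ℝ) + 1) z * (vol n (Metric.ball 0 c) * ‖g z‖ₑ ^ p) ≤
      Wt ((n : ℝ) + 1) z * (K * I) := by
    calc _ = Wt ((n : ℝ) + 1) z * vol n (Metric.ball 0 c) * ‖g z‖ₑ ^ p := by ring
      _ ≤ _ := h5
      _ = _ := by ring
  rw [ENNReal.mul_le_mul_iff_right (Wt_ne_zero hz _) (Wt_ne_top _ _)] at h6
  rw [mul_assoc]
  calc ‖g z‖ₑ ^ p = (vol n (Metric.ball 0 c))⁻¹ * (vol n (Metric.ball 0 c) * ‖g z‖ₑ ^ p) := by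
        rw [← mul_assoc, ENNReal.inv_mul_cancel hv0 hv1, one_mul]
    _ ≤ _ := by gcongr

theorem submean_KD' (n : ℕ) (M : ℝ) : ∃ M' : ℝ, ∃ C : ℝ≥0∞, C ≠ ⊤ ∧ ∀ p : ℝ, 0 < p →
    ∀ g : En n → ℂ, DifferentiableOn ℂ g (uball n) → ∀ z : En n, ‖z‖ < 1 → ∀ w ∈ KD M z,
    ‖g w‖ₑ ^ p ≤ C * ∫⁻ u in KD M' z, ‖g u‖ₑ ^ p ∂measTau n := by
  obtain ⟨M', h⟩ := KD_trans n M 2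
  obtain ⟨C, hC, h2⟩ := submean_KD n one_lt_two
  refine ⟨M', C, hC, fun p hp g hg z hz w hw => (h2 p hp g hg w hw.1).trans ?_⟩
  gcongr
  intro u hu
  exact h z w u hz hw hu

theorem herm_eq {n : ℕ} (z w : En n) : herm w z = inner ℂ z w := by
  simp [herm, PiLp.inner_apply]

theorem mob_num {n : ℕ} {z w : En n} (hz : ‖z‖ < 1) :
    ‖z - prj z w - ((Real.sqrt (1 - ‖z‖ ^ 2) : ℝ) : ℂ) • (w - prj z w)‖ ^ 2 =
      ‖1 - inner ℂ z w‖ ^ 2 - dd z * dd w := by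
  by_cases h0 : z = 0
  · subst h0
    simp [prj, dd]
  set s := Real.sqrt (1 - ‖z‖ ^ 2) with hs
  have hs2 : s ^ 2 = 1 - ‖z‖ ^ 2 := Real.sq_sqrt (dd_pos hz).le
  have hs2' : (s : ℂ) ^ 2 = 1 - (‖z‖ : ℂ) ^ 2 := by exact_mod_cast hs2
  have hp : prj z w = (herm w z / herm z z) • z := by simp [prj, h0]
  set a := inner ℂ z w with ha
  have hwz : inner ℂ w z = (starRingEnd ℂ) a := by rw [ha, inner_conj_symm]
  set c := herm w z / herm z z with hc
  have hzz : (‖z‖ : ℂ) ≠ 0 := by exact_mod_cast (norm_ne_zero_iff.mpr h0)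
  have hct : c * (‖z‖ : ℂ) ^ 2 = a := by
    rw [hc, herm_eq, herm_eq, inner_self_eq_norm_sq_to_K]
    have : ((‖z‖ : ℂ)) ^ 2 ≠ 0 := pow_ne_zero _ hzz
    exact div_mul_cancel₀ _ this
  have hct' : (starRingEnd ℂ) c * (‖z‖ : ℂ) ^ 2 = (starRingEnd ℂ) a := by
    rw [← hct]; simp
  rw [hp]
  have e : z - c • z - (s : ℂ) • (w - c • z) = (1 - c + s * c) • z - (s : ℂ) • w := by
    module
  rw [e]
  have h1 : ((‖(1 - c + s * c) • z - (s : ℂ) • w‖ : ℂ)) ^ 2 =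
      ((1 : ℂ) - a) * (starRingEnd ℂ) (1 - a) - (dd z : ℂ) * (dd w : ℂ) := by
    have := inner_self_eq_norm_sq_to_K (𝕜 := ℂ) ((1 - c + s * c) • z - (s : ℂ) • w)
    refine Eq.trans this.symm ?_
    simp only [inner_sub_left, inner_sub_right, inner_smul_left, inner_smul_right]
    simp only [inner_self_eq_norm_sq_to_K, hwz]
    rw [← ha]
    simp only [map_add, map_sub, map_mul, map_one, Complex.conj_ofReal, dd]
    push_cast
    simp only [Complex.coe_algebraMap]
    generalize (starRingEnd ℂ) c = d at *
    generalize (starRingEnd ℂ) a = b at *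
    generalize (‖z‖ : ℂ) = t at *
    generalize (‖w‖ : ℂ) = u at *
    generalize (s : ℂ) = r at *
    rw [← hct, ← hct']
    linear_combination (u^2 - c * d * t^2) * hs2'
  rw [Complex.mul_conj] at h1
  have h2 : ‖(1 - c + s * c) • z - (s : ℂ) • w‖ ^ 2 = Complex.normSq (1 - a) - dd z * dd w := by
    exact_mod_cast h1
  rw [h2, Complex.normSq_eq_norm_sq]

theorem one_sub_inner_pos {n : ℕ} {z w : En n} (hz : ‖z‖ < 1) (hw : ‖w‖ < 1) :
    0 < ‖1 - inner ℂ z w‖ := by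
  linarith [one_sub_inner_ge hz hw, dd_pos hz]

theorem mob_norm {n : ℕ} {z w : En n} (hz : ‖z‖ < 1) (hw : ‖w‖ < 1) :
    (1 - ‖mobius z w‖ ^ 2) * ‖1 - inner ℂ z w‖ ^ 2 = dd z * dd w := by
  have h := mob_num (w := w) hz
  have hp := one_sub_inner_pos hz hw
  unfold mobius
  rw [norm_smul, mul_pow, h, herm_eq, norm_div, norm_one]
  field_simp
  ring

theorem bmet_iff {x γ : ℝ} (hx0 : 0 ≤ x) (hx1 : x < 1) (hγ : 0 < γ) :
    (1 / 2) * Real.log ((1 + x) / (1 - x)) < γ ↔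
      1 < (1 / (1 - ((Real.exp (2 * γ) - 1) / (Real.exp (2 * γ) + 1)) ^ 2)) * (1 - x ^ 2) := by
  set T := Real.exp (2 * γ) with hT
  have hT1 : 1 < T := by rw [hT]; exact Real.one_lt_exp_iff.mpr (by linarith)
  have h1 : (1 / 2) * Real.log ((1 + x) / (1 - x)) < γ ↔ (1 + x) / (1 - x) < T := by
    rw [hT, ← Real.log_lt_iff_lt_exp (div_pos (by linarith) (by linarith))]
    constructor <;> intro h <;> linarith
  rw [h1, div_lt_iff₀ (by linarith)]
  have h2 : 1 / (1 - ((T - 1) / (T + 1)) ^ 2) = (T + 1) ^ 2 / (4 * T) := by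
    have : T + 1 ≠ 0 := by linarith
    have e : 1 - ((T - 1) / (T + 1)) ^ 2 = 4 * T / (T + 1) ^ 2 := by
      field_simp; ring
    rw [e, one_div_div]
  rw [h2, div_mul_eq_mul_div, lt_div_iff₀ (by linarith)]
  have e : (T + 1) ^ 2 * (1 - x ^ 2) - 4 * T = (T - 1 - x * (T + 1)) * (T - 1 + x * (T + 1)) := by
    ring
  have hpos : 0 < T - 1 + x * (T + 1) := by nlinarith
  constructor
  · intro h
    have : 0 < T - 1 - x * (T + 1) := by linarith
    have := mul_pos this hpos
    linarith
  · intro h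
    have : 0 < (T - 1 - x * (T + 1)) * (T - 1 + x * (T + 1)) := by linarith
    have := pos_of_mul_pos_left this hpos.le
    linarith

theorem Dball_KD (n : ℕ) {γ : ℝ} (hγ : 0 < γ) : ∃ M : ℝ, 1 < M ∧ ∀ z : En n, ‖z‖ < 1 →
    Dball z γ = KD M z := by
  refine ⟨1 / (1 - ((Real.exp (2 * γ) - 1) / (Real.exp (2 * γ) + 1)) ^ 2), ?_, fun z hz => ?_⟩
  · have := (bmet_iff (x := 0) le_rfl one_pos hγ).1 (by simpa using hγ)
    simpa using this
  ext w
  simp only [Dball, KD, Set.mem_ofPred_eq, mem_uball]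
  apply and_congr_right
  intro hw
  have h := mob_norm hz hw
  have hp := one_sub_inner_pos hz hw
  have hdd := mul_pos (dd_pos hz) (dd_pos hw)
  have hx1 : ‖mobius z w‖ < 1 := by
    have : 0 < 1 - ‖mobius z w‖ ^ 2 := by
      rw [← h] at hdd
      exact pos_of_mul_pos_left hdd (by positivity)
    nlinarith [norm_nonneg (mobius z w)]
  unfold bmet
  rw [bmet_iff (norm_nonneg _) hx1 hγ, ← h, ← mul_assoc]
  constructor
  · intro h3
    have := mul_lt_mul_of_pos_right h3 (pow_pos hp 2)
    linarith
  · intro h3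
    have h4 := pow_pos hp 2
    by_contra hc
    push Not at hc
    have := mul_le_mul_of_nonneg_right hc h4.le
    linarith

def Yv {n : ℕ} (p s : ℝ) (g : En n → ℂ) : ℝ≥0∞ := ∫⁻ z in uball n, Wt s z * ‖g z‖ₑ ^ p ∂vol n

theorem Yv_tau {n : ℕ} (p s : ℝ) (g : En n → ℂ) :
    Yv p s g = ∫⁻ z, Wt (s + ((n : ℝ) + 1)) z * ‖g z‖ₑ ^ p ∂measTau n := by
  unfold Yv
  rw [lint_vol]
  apply lintegral_congr_ae
  filter_upwards [ae_tau] with z hz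
  rw [← mul_assoc, ← Wt_add hz, add_comm s]

theorem ind_meas {n : ℕ} (p : ℝ) {g : En n → ℂ} (hg : DifferentiableOn ℂ g (uball n)) :
    Measurable ((uball n).indicator (fun w => ‖g w‖ₑ ^ p)) := by
  apply meas_ind
  exact ENNReal.continuous_rpow_const.comp_continuousOn hg.continuousOn.enorm

theorem fubini_hol (n : ℕ) (M s : ℝ) : ∃ C : ℝ≥0∞, C ≠ ⊤ ∧ ∀ p : ℝ, ∀ g : En n → ℂ,
    DifferentiableOn ℂ g (uball n) →
    ∫⁻ z, Wt s z * (∫⁻ w in KD M z, ‖g w‖ₑ ^ p ∂measTau n) ∂measTau n ≤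
      C * ∫⁻ w, Wt s w * ‖g w‖ₑ ^ p ∂measTau n := by
  obtain ⟨C, hC, h⟩ := fubini_KD n M s
  refine ⟨C, hC, fun p g hg => ?_⟩
  have h1 := h _ (ind_meas p hg)
  have e1 : ∀ z : En n, ∫⁻ w in KD M z, (uball n).indicator (fun w => ‖g w‖ₑ ^ p) w ∂measTau n =
      ∫⁻ w in KD M z, ‖g w‖ₑ ^ p ∂measTau n := by
    intro z
    apply setLIntegral_congr_fun (KD_meas M z)
    intro w hw
    simp [KD_sub M z hw]
  have e2 : ∫⁻ w, Wt s w * (uball n).indicator (fun w => ‖g w‖ₑ ^ p) w ∂measTau n =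
      ∫⁻ w, Wt s w * ‖g w‖ₑ ^ p ∂measTau n := by
    apply lintegral_congr_ae
    filter_upwards [ae_tau] with z hz
    simp [mem_uball.mpr hz]
  simp_rw [e1] at h1
  rwa [e2] at h1

def Ar {n : ℕ} (M q m : ℝ) (G : En n → ℂ) (z : En n) : ℝ≥0∞ :=
  (∫⁻ w in KD M z, (Wt m w * ‖G w‖ₑ) ^ q ∂measTau n) ^ (1 / q)

theorem areaF_Ar (n : ℕ) {γ : ℝ} (hγ : 0 < γ) : ∃ M : ℝ, 1 < M ∧ ∀ q m : ℝ, ∀ G : En n → ℂ,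
    ∀ z : En n, ‖z‖ < 1 →
    areaF γ q (fun w => (1 - ‖w‖ ^ 2) ^ m * ‖G w‖) z = Ar M q m G z := by
  obtain ⟨M, hM, h⟩ := Dball_KD n hγ
  refine ⟨M, hM, fun q m G z hz => ?_⟩
  unfold areaF Ar
  rw [h z hz]
  congr 1
  apply setLIntegral_congr_fun (KD_meas M z)
  intro w hw
  simp only
  change ENNReal.ofReal (dd w ^ m * ‖G w‖) ^ q = _
  rw [ENNReal.ofReal_mul (Real.rpow_nonneg (dd_pos hw.1).le m), ofReal_norm_eq_enorm]
  rfl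

theorem Ar_lower (n : ℕ) {M : ℝ} (hM : 1 < M) {q : ℝ} (hq : 0 < q) (m : ℝ) :
    ∃ C : ℝ≥0∞, C ≠ ⊤ ∧ ∀ G : En n → ℂ, DifferentiableOn ℂ G (uball n) → ∀ z : En n, ‖z‖ < 1 →
      Wt m z * ‖G z‖ₑ ≤ C * Ar M q m G z := by
  obtain ⟨C0, hC0, h⟩ := submean_KD n hM
  set K := ENNReal.ofReal ((4 * M) ^ |m|) with hK
  refine ⟨(C0 * K ^ q) ^ (1 / q), ?_, fun G hG z hz => ?_⟩
  · apply ENNReal.rpow_ne_top_of_nonneg (by positivity)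
    exact ENNReal.mul_ne_top hC0 (ENNReal.rpow_ne_top_of_nonneg hq.le ENNReal.ofReal_ne_top)
  unfold Ar
  rw [← ENNReal.mul_rpow_of_nonneg _ _ (by positivity), one_div, ENNReal.le_rpow_inv_iff hq,
    ENNReal.mul_rpow_of_nonneg _ _ hq.le]
  calc Wt m z ^ q * ‖G z‖ₑ ^ q ≤ Wt m z ^ q * (C0 * ∫⁻ w in KD M z, ‖G w‖ₑ ^ q ∂measTau n) := by
        gcongr; exact h q hq G hG z hz
    _ = C0 * ∫⁻ w in KD M z, Wt m z ^ q * ‖G w‖ₑ ^ q ∂measTau n := by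
        rw [lintegral_const_mul' _ _ (ENNReal.rpow_ne_top_of_nonneg hq.le (Wt_ne_top _ _))]; ring
    _ ≤ C0 * ∫⁻ w in KD M z, K ^ q * (Wt m w * ‖G w‖ₑ) ^ q ∂measTau n := by
        gcongr C0 * ?_
        apply setLIntegral_mono' (KD_meas M z)
        intro w hw
        rw [← ENNReal.mul_rpow_of_nonneg _ _ hq.le, ← ENNReal.mul_rpow_of_nonneg _ _ hq.le,
          ← mul_assoc]
        gcongr
        exact Wt_cmp' hz hw m
    _ = _ := by
        rw [lintegral_const_mul' _ _ (ENNReal.rpow_ne_top_of_nonneg hq.le ENNReal.ofReal_ne_top)]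
        ring

theorem Ar_upper (n : ℕ) (M : ℝ) {q : ℝ} (hq : 0 < q) {p : ℝ} (hp : 0 < p) (m : ℝ) :
    ∃ M' : ℝ, ∃ C : ℝ≥0∞, C ≠ ⊤ ∧ ∀ G : En n → ℂ, DifferentiableOn ℂ G (uball n) →
      ∀ z : En n, ‖z‖ < 1 →
      Ar M q m G z ^ p ≤ C * (Wt (m * p) z * ∫⁻ u in KD M' z, ‖G u‖ₑ ^ p ∂measTau n) := by
  obtain ⟨M', C0, hC0, h⟩ := submean_KD' n M
  obtain ⟨C1, hC1, h1⟩ := tau_KD n M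
  set K := ENNReal.ofReal ((4 * M) ^ |m|) with hK
  refine ⟨M', C1 ^ (p / q) * K ^ p * C0, ?_, fun G hG z hz => ?_⟩
  · refine ENNReal.mul_ne_top (ENNReal.mul_ne_top ?_ ?_) hC0
    · exact ENNReal.rpow_ne_top_of_nonneg (by positivity) hC1
    · exact ENNReal.rpow_ne_top_of_nonneg hp.le ENNReal.ofReal_ne_top
  set I := ∫⁻ u in KD M' z, ‖G u‖ₑ ^ p ∂measTau n with hI
  set B := K * Wt m z * (C0 * I) ^ p⁻¹ with hB
  have hA : Ar M q m G z ≤ C1 ^ (1 / q) * B := by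
    unfold Ar
    rw [one_div, ENNReal.rpow_inv_le_iff hq, ENNReal.mul_rpow_of_nonneg _ _ hq.le,
      ENNReal.rpow_inv_rpow hq.ne']
    calc ∫⁻ w in KD M z, (Wt m w * ‖G w‖ₑ) ^ q ∂measTau n
        ≤ ∫⁻ w in KD M z, B ^ q ∂measTau n := by
          apply setLIntegral_mono' (KD_meas M z)
          intro w hw
          gcongr
          rw [hB]
          gcongr
          · exact Wt_cmp hz hw m
          · rw [ENNReal.le_rpow_inv_iff hp]
            exact h p hp G hG z hz w hw
      _ = measTau n (KD M z) * B ^ q := by rw [setLIntegral_const, mul_comm]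
      _ ≤ _ := by gcongr; exact h1 z hz
  calc Ar M q m G z ^ p ≤ (C1 ^ (1 / q) * B) ^ p := by gcongr
    _ = _ := by
      rw [hB, ENNReal.mul_rpow_of_nonneg _ _ hp.le, ENNReal.mul_rpow_of_nonneg _ _ hp.le,
        ENNReal.mul_rpow_of_nonneg _ _ hp.le, ENNReal.rpow_inv_rpow hp.ne', Wt_rpow hz,
        ← ENNReal.rpow_mul, one_div_mul_eq_div]
      ring

theorem area_cmp (n : ℕ) {γ q p : ℝ} (hγ : 0 < γ) (hq : 0 < q) (hp : 0 < p) (m α : ℝ) :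
    ∃ C : ℝ≥0∞, C ≠ ⊤ ∧ ∀ G : En n → ℂ, DifferentiableOn ℂ G (uball n) →
      Yv p (α + m * p) G ≤ C * ∫⁻ z in uball n, Wt α z *
        areaF γ q (fun w => (1 - ‖w‖ ^ 2) ^ m * ‖G w‖) z ^ p ∂vol n ∧
      ∫⁻ z in uball n, Wt α z *
        areaF γ q (fun w => (1 - ‖w‖ ^ 2) ^ m * ‖G w‖) z ^ p ∂vol n ≤ C * Yv p (α + m * p) G := by
  obtain ⟨M, hM, h⟩ := areaF_Ar n hγ
  obtain ⟨C1, hC1, h1⟩ := Ar_lower n hM hq m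
  obtain ⟨M', C2, hC2, h2⟩ := Ar_upper n M hq hp m
  obtain ⟨C3, hC3, h3⟩ := fubini_hol n M' (α + m * p + (n + 1))
  refine ⟨C1 ^ p + C2 * C3, ?_, fun G hG => ?_⟩
  · exact ENNReal.add_ne_top.mpr ⟨ENNReal.rpow_ne_top_of_nonneg hp.le hC1,
      ENNReal.mul_ne_top hC2 hC3⟩
  have e : ∫⁻ z in uball n, Wt α z *
        areaF γ q (fun w => (1 - ‖w‖ ^ 2) ^ m * ‖G w‖) z ^ p ∂vol n =
      ∫⁻ z in uball n, Wt α z * Ar M q m G z ^ p ∂vol n := by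
    apply setLIntegral_congr_fun (uball_meas n)
    intro z hz
    simp only
    rw [h q m G z (mem_uball.mp hz)]
  rw [e]
  constructor
  · calc Yv p (α + m * p) G ≤ ∫⁻ z in uball n, C1 ^ p * (Wt α z * Ar M q m G z ^ p) ∂vol n := by
          unfold Yv
          apply setLIntegral_mono' (uball_meas n)
          intro z hz
          rw [mem_uball] at hz
          rw [Wt_add hz, ← Wt_rpow hz, mul_assoc, ← ENNReal.mul_rpow_of_nonneg _ _ hp.le,
            mul_left_comm, ← ENNReal.mul_rpow_of_nonneg _ _ hp.le]
          gcongr Wt α z * ?_ ^ p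
          exact h1 G hG z hz
      _ = C1 ^ p * ∫⁻ z in uball n, (Wt α z * Ar M q m G z ^ p) ∂vol n := by
          rw [lintegral_const_mul' _ _ (ENNReal.rpow_ne_top_of_nonneg hp.le hC1)]
      _ ≤ _ := by gcongr; exact le_self_add
  · rw [lint_vol]
    calc ∫⁻ z, Wt ((n : ℝ) + 1) z * (Wt α z * Ar M q m G z ^ p) ∂measTau n
        ≤ ∫⁻ z, C2 * (Wt (α + m * p + (n + 1)) z * ∫⁻ u in KD M' z, ‖G u‖ₑ ^ p ∂measTau n)
            ∂measTau n := by
          apply lintegral_mono_ae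
          filter_upwards [ae_tau] with z hz
          rw [Wt_add hz (α + m * p), Wt_add hz α]
          calc Wt ((n : ℝ) + 1) z * (Wt α z * Ar M q m G z ^ p)
              ≤ Wt ((n : ℝ) + 1) z * (Wt α z *
                (C2 * (Wt (m * p) z * ∫⁻ u in KD M' z, ‖G u‖ₑ ^ p ∂measTau n))) := by
                gcongr; exact h2 G hG z hz
            _ = _ := by ring
      _ = C2 * ∫⁻ z, (Wt (α + m * p + (n + 1)) z * ∫⁻ u in KD M' z, ‖G u‖ₑ ^ p ∂measTau n)
            ∂measTau n := lintegral_const_mul' _ _ hC2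
      _ ≤ C2 * (C3 * Yv p (α + m * p) G) := by
          rw [Yv_tau]
          gcongr
          exact h3 p G hG
      _ ≤ _ := by rw [← mul_assoc]; gcongr; exact le_add_self

theorem fderiv_bd {n : ℕ} {f : En n → ℂ} (hf : DifferentiableOn ℂ f (uball n)) {ρ : ℝ}
    (hρ : ρ < 1) : ∃ C : ℝ, 0 ≤ C ∧ ∀ w : En n, ‖w‖ ≤ ρ → ‖f w‖ ≤ C ∧ ‖fderiv ℂ f w‖ ≤ C := by
  set r := (1 - ρ) / 2 with hr
  have hr0 : 0 < r := by rw [hr]; linarith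
  have hsub : Metric.closedBall (0 : En n) (1 - r) ⊆ uball n := by
    intro w hw
    rw [mem_closedBall_zero_iff] at hw
    rw [mem_uball]; linarith
  obtain ⟨A, hA⟩ := (isCompact_closedBall (0 : En n) (1 - r)).exists_bound_of_continuousOn
    (hf.continuousOn.mono hsub)
  have hA' : ∀ w : En n, ‖w‖ ≤ 1 - r → ‖f w‖ ≤ |A| := fun w hw =>
    (hA w (by simpa using hw)).trans (le_abs_self A)
  refine ⟨|A| + (2 * |A|) / r, by positivity, fun w hw => ⟨?_, ?_⟩⟩
  · have := hA' w (by rw [hr]; linarith)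
    have h2 : 0 ≤ (2 * |A|) / r := by positivity
    linarith
  · have hb : ∀ u ∈ Metric.ball w r, ‖u‖ ≤ 1 - r := by
      intro u hu
      rw [mem_ball_iff_norm] at hu
      have : ‖u‖ ≤ ‖w‖ + ‖u - w‖ := by
        simpa using norm_add_le w (u - w)
      have e : ρ + r = 1 - r := by rw [hr]; ring
      linarith
    have h3 := Complex.norm_fderiv_le_div_of_mapsTo_ball (f := f) (c := w) (R₁ := r) (R₂ := 2 * |A|)
      (hf.mono (fun u hu => hsub (by simpa using hb u hu))) (by
        intro u hu
        rw [mem_closedBall_iff_norm]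
        have h4 := norm_sub_le (f u) (f w)
        have h5 := hA' u (hb u hu)
        have h6 := hA' w (hb w (Metric.mem_ball_self hr0))
        linarith) hr0
    have : 0 ≤ |A| := abs_nonneg A
    linarith

theorem diffAt {n : ℕ} {f : En n → ℂ} (hf : DifferentiableOn ℂ f (uball n)) {z : En n}
    (hz : ‖z‖ < 1) : DifferentiableAt ℂ f z :=
  hf.differentiableAt (Metric.isOpen_ball.mem_nhds (mem_uball.mpr hz))

theorem ray_deriv {n : ℕ} {f : En n → ℂ} (hf : DifferentiableOn ℂ f (uball n)) {z : En n} {l : ℂ}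
    (hz : ‖l • z‖ < 1) : HasDerivAt (fun l : ℂ => f (l • z)) (fderiv ℂ f (l • z) z) l := by
  have h := (diffAt hf hz).hasFDerivAt
  have h2 : HasDerivAt (fun l : ℂ => l • z) z l := by
    simpa using (hasDerivAt_id l).smul_const z
  exact h.comp_hasDerivAt l h2

theorem radD_diff {n : ℕ} {f : En n → ℂ} (hf : DifferentiableOn ℂ f (uball n)) :
    DifferentiableOn ℂ (radD f) (uball n) := by
  intro z0 hz0
  apply DifferentiableAt.differentiableWithinAt
  rw [mem_uball] at hz0
  set r := (1 - ‖z0‖) / 4 with hr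
  have hr0 : 0 < r := by rw [hr]; linarith
  have hr1 : r ≤ 1 / 4 := by rw [hr]; linarith [norm_nonneg z0]
  obtain ⟨C, hC0, hC⟩ := fderiv_bd hf (ρ := 1 - r) (by linarith)
  have key : ∀ z ∈ Metric.ball z0 r, ∀ l ∈ Metric.closedBall (1 : ℂ) r, ‖l • z‖ ≤ 1 - r := by
    intro z hz l hl
    rw [mem_ball_iff_norm] at hz
    rw [mem_closedBall_iff_norm] at hl
    have h1 : ‖z‖ ≤ ‖z0‖ + ‖z - z0‖ := by simpa using norm_add_le z0 (z - z0)
    have h2 : ‖l‖ ≤ 1 + r := by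
      have : ‖l‖ ≤ ‖(1 : ℂ)‖ + ‖l - 1‖ := by simpa using norm_add_le 1 (l - 1)
      rw [norm_one] at this; linarith
    rw [norm_smul]
    have h3 : ‖l‖ * ‖z‖ ≤ (1 + r) * (‖z0‖ + r) := by
      gcongr; linarith
    have h4 : ‖z0‖ = 1 - 4 * r := by rw [hr]; ring
    nlinarith
  have hcm : ∀ θ : ℝ, circleMap 1 r θ ∈ Metric.closedBall (1 : ℂ) r := fun θ =>
    circleMap_mem_closedBall _ hr0.le _
  have hne : ∀ θ : ℝ, circleMap (1 : ℂ) r θ - 1 ≠ 0 := fun θ =>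
    sub_ne_zero.mpr (circleMap_ne_center hr0.ne')
  set D : ℝ → ℂ := fun θ => deriv (circleMap 1 r) θ * ((circleMap 1 r θ - 1) ^ 2)⁻¹ with hD
  have hDc : Continuous D := by
    have : Continuous (fun θ : ℝ => deriv (circleMap 1 r) θ) := by
      simp only [deriv_circleMap]
      exact (continuous_circleMap 0 r).mul continuous_const
    apply this.mul
    apply Continuous.inv₀ (by fun_prop)
    intro θ
    exact pow_ne_zero _ (hne θ)
  have hDb : ∀ θ, ‖D θ‖ = r⁻¹ := by
    intro θ
    rw [hD]
    simp [circleMap, abs_of_pos hr0]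
    field_simp
  set F : En n → ℝ → ℂ := fun z θ => D θ * f (circleMap 1 r θ • z) with hF
  set F' : En n → ℝ → (En n →L[ℂ] ℂ) := fun z θ =>
    (D θ * circleMap 1 r θ) • fderiv ℂ f (circleMap 1 r θ • z) with hF'
  have hrep : ∀ z ∈ Metric.ball z0 r, radD f z =
      (2 * Real.pi * Complex.I : ℂ)⁻¹ • ∫ θ in Set.Ioc 0 (2 * Real.pi), F z θ := by
    intro z hz
    have hU : IsOpen {l : ℂ | ‖l • z‖ < 1} := isOpen_lt (by fun_prop) continuous_const
    have h1 := Complex.cderiv_eq_deriv (f := fun l : ℂ => f (l • z)) (z := 1) hU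
      (fun l hl => (ray_deriv hf hl).differentiableAt.differentiableWithinAt) hr0
      (fun l hl => lt_of_le_of_lt (key z hz l hl) (by linarith))
    have h2 := ray_deriv (l := 1) hf (lt_of_le_of_lt (key z hz 1
      (Metric.mem_closedBall_self hr0.le)) (by linarith))
    rw [h2.deriv, one_smul] at h1
    unfold radD
    rw [← h1, Complex.cderiv, circleIntegral, intervalIntegral.integral_of_le (by positivity)]
    congr 2
    ext θ
    simp only [hF, hD, smul_eq_mul]
    ring
  have hfc : ∀ z ∈ Metric.ball z0 r, Continuous (F z) := by
    intro z hz
    apply hDc.mul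
    rw [continuous_iff_continuousAt]
    intro θ
    have h1 : ContinuousAt f (circleMap 1 r θ • z) := (diffAt hf (lt_of_le_of_lt
      (key z hz _ (hcm θ)) (by linarith))).continuousAt
    exact ContinuousAt.comp (f := fun θ => circleMap 1 r θ • z) (g := f) h1 (by fun_prop)
  have : ProperSpace (En n →L[ℂ] ℂ) := FiniteDimensional.proper ℂ _
  have hmain : HasFDerivAt (fun z => ∫ θ in Set.Ioc 0 (2 * Real.pi), F z θ)
      (∫ θ in Set.Ioc 0 (2 * Real.pi), F' z0 θ) z0 := by
    apply hasFDerivAt_integral_of_dominated_of_fderiv_le (s := Metric.ball z0 r)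
      (bound := fun _ => r⁻¹ * 2 * C) (Metric.ball_mem_nhds z0 hr0)
    · filter_upwards [Metric.ball_mem_nhds z0 hr0] with z hz
      exact (hfc z hz).aestronglyMeasurable
    · exact (hfc z0 (Metric.mem_ball_self hr0)).integrableOn_Ioc
    · apply Measurable.aestronglyMeasurable
      refine Measurable.fun_smul (f := fun θ => D θ * circleMap 1 r θ)
        (g := fun θ => fderiv ℂ f (circleMap 1 r θ • z0)) ?_ ?_
      · exact (hDc.mul (continuous_circleMap 1 r)).measurable
      · exact (measurable_fderiv ℂ f).comp (by fun_prop)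
    · refine Eventually.of_forall fun θ z hz => ?_
      rw [hF']
      simp only
      rw [norm_smul, norm_mul, hDb]
      gcongr
      · have := hcm θ
        rw [mem_closedBall_iff_norm] at this
        have h2 : ‖circleMap 1 r θ‖ ≤ ‖(1 : ℂ)‖ + ‖circleMap 1 r θ - 1‖ := by
          have := norm_add_le 1 (circleMap 1 r θ - 1)
          rwa [add_sub_cancel] at this
        rw [norm_one] at h2
        linarith
      · exact (hC _ (key z hz _ (hcm θ))).2
    · exact integrable_const _
    · refine Eventually.of_forall fun θ z hz => ?_
      have h1 := (diffAt hf (lt_of_le_of_lt (key z hz _ (hcm θ)) (by linarith))).hasFDerivAt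
      have h2 : HasFDerivAt (fun z : En n => circleMap 1 r θ • z)
        (circleMap 1 r θ • ContinuousLinearMap.id ℂ (En n)) z :=
        (hasFDerivAt_id (𝕜 := ℂ) z).const_smul (circleMap 1 r θ)
      have h3 := (h1.comp z h2).const_mul (D θ)
      refine HasFDerivAt.congr_fderiv (f := fun x => F x θ) h3 ?_
      ext v
      simp [hF', mul_assoc]
  have := hmain.differentiableAt.const_smul ((2 * Real.pi * Complex.I : ℂ)⁻¹)
  apply this.congr_of_eventuallyEq
  filter_upwards [Metric.ball_mem_nhds z0 hr0] with z hz
  rw [hrep z hz]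
  rfl

theorem radIter_diff {n : ℕ} {f : En n → ℂ} (hf : DifferentiableOn ℂ f (uball n)) (j : ℕ) :
    DifferentiableOn ℂ (radIter j f) (uball n) := by
  induction j with
  | zero => exact hf
  | succ j ih => exact radD_diff ih

theorem radD_zero {n : ℕ} (f : En n → ℂ) : radD f 0 = 0 := by simp [radD]

theorem ray_KD {n : ℕ} {z : En n} (hz : ‖z‖ < 1) {l : ℂ} (hl : ‖l - 1‖ ≤ dd z / 8) :
    l • z ∈ KD 4 z := by
  have hd := dd_pos hz
  have hd1 := dd_le_one z
  have e : ‖z‖ ^ 2 = 1 - dd z := by simp [dd]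
  have h2 : ‖l‖ ≤ 1 + dd z / 8 := by
    have : ‖l‖ ≤ ‖(1 : ℂ)‖ + ‖l - 1‖ := by simpa using norm_add_le 1 (l - 1)
    rw [norm_one] at this; linarith
  have h3 : ‖l • z‖ ^ 2 ≤ (1 + dd z / 8) ^ 2 * (1 - dd z) := by
    rw [norm_smul, mul_pow, e]
    have : 0 ≤ 1 - dd z := by linarith
    gcongr
  have h4 : 47 / 64 * dd z ≤ dd (l • z) := by
    have : dd (l • z) = 1 - ‖l • z‖ ^ 2 := rfl
    nlinarith [mul_pos hd hd, mul_pos (mul_pos hd hd) hd]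
  have h5 : ‖l • z‖ < 1 := by
    have : dd (l • z) = 1 - ‖l • z‖ ^ 2 := rfl
    nlinarith [norm_nonneg (l • z)]
  refine ⟨h5, ?_⟩
  have h6 : ‖1 - inner ℂ z (l • z)‖ ≤ 9 / 8 * dd z := by
    have : (1 : ℂ) - inner ℂ z (l • z) = (dd z : ℂ) - (l - 1) * (‖z‖ : ℂ) ^ 2 := by
      rw [inner_smul_right, inner_self_eq_norm_sq_to_K]
      simp [dd]; ring
    rw [this]
    refine (norm_sub_le _ _).trans ?_
    rw [Complex.norm_real, Real.norm_of_nonneg hd.le, norm_mul, norm_pow, Complex.norm_real,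
      norm_norm, e]
    nlinarith [norm_nonneg (l - 1)]
  have h7 : ‖1 - inner ℂ z (l • z)‖ ^ 2 ≤ (9 / 8 * dd z) ^ 2 := by gcongr
  nlinarith

theorem enorm_le_of_rpow {x : ℂ} {A : ℝ≥0∞} {p : ℝ} (hp : 0 < p) (hA : A ≠ ⊤)
    (h : ‖x‖ₑ ^ p ≤ A) : ‖x‖ ≤ (A ^ p⁻¹).toReal := by
  rw [← ENNReal.le_rpow_inv_iff hp] at h
  have h2 : A ^ p⁻¹ ≠ ⊤ := ENNReal.rpow_ne_top_of_nonneg (by positivity) hA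
  rw [← ENNReal.ofReal_le_iff_le_toReal h2, ofReal_norm]
  exact h

theorem enorm_rpow_le {x : ℂ} {A : ℝ≥0∞} {c p : ℝ} (hp : 0 < p) (hc : 0 ≤ c) (hA : A ≠ ⊤)
    (h : ‖x‖ ≤ c * (A ^ p⁻¹).toReal) : ‖x‖ₑ ^ p ≤ ENNReal.ofReal (c ^ p) * A := by
  have h2 : A ^ p⁻¹ ≠ ⊤ := ENNReal.rpow_ne_top_of_nonneg (by positivity) hA
  have h3 : ‖x‖ₑ ≤ ENNReal.ofReal c * A ^ p⁻¹ := by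
    rw [← ofReal_norm]
    refine (ENNReal.ofReal_le_ofReal h).trans ?_
    rw [ENNReal.ofReal_mul hc, ENNReal.ofReal_toReal h2]
  calc ‖x‖ₑ ^ p ≤ (ENNReal.ofReal c * A ^ p⁻¹) ^ p := by gcongr
    _ = _ := by
      rw [ENNReal.mul_rpow_of_nonneg _ _ hp.le, ENNReal.rpow_inv_rpow hp.ne',
        ENNReal.ofReal_rpow_of_nonneg hc hp.le]

theorem radD_point (n : ℕ) {p : ℝ} (hp : 0 < p) : ∃ M' : ℝ, ∃ C : ℝ≥0∞, C ≠ ⊤ ∧ ∀ g : En n → ℂ,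
    DifferentiableOn ℂ g (uball n) → ∀ z : En n, ‖z‖ < 1 →
    Wt p z * ‖radD g z‖ₑ ^ p ≤ C * ∫⁻ u in KD M' z, ‖g u‖ₑ ^ p ∂measTau n := by
  obtain ⟨M', C0, hC0, h⟩ := submean_KD' n 4
  refine ⟨M', ENNReal.ofReal (8 ^ p) * C0, ENNReal.mul_ne_top ENNReal.ofReal_ne_top hC0,
    fun g hg z hz => ?_⟩
  set A := C0 * ∫⁻ u in KD M' z, ‖g u‖ₑ ^ p ∂measTau n with hA
  rw [mul_assoc, ← hA]
  have h1 : ∀ w ∈ KD 4 z, ‖g w‖ₑ ^ p ≤ A := fun w hw => h p hp g hg z hz w hw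
  have hd := dd_pos hz
  by_cases hAt : A = ⊤
  · rw [hAt, ENNReal.mul_top]
    · exact le_top
    · simp; positivity
  have h2 : ‖deriv (fun l : ℂ => g (l • z)) 1‖ ≤ (A ^ p⁻¹).toReal / (dd z / 8) := by
    apply Complex.norm_deriv_le_of_forall_mem_sphere_norm_le (by positivity)
    · apply DifferentiableOn.diffContOnCl
      intro l hl
      have hl' := Metric.closure_ball_subset_closedBall hl
      rw [mem_closedBall_iff_norm] at hl'
      exact (ray_deriv hg (ray_KD hz hl').1).differentiableAt.differentiableWithinAt
    · intro l hl
      rw [mem_sphere_iff_norm] at hl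
      exact enorm_le_of_rpow hp hAt (h1 _ (ray_KD hz hl.le))
  rw [(ray_deriv hg (l := 1) (by simpa using hz)).deriv, one_smul] at h2
  have h3 : ‖radD g z‖ ≤ (8 / dd z) * (A ^ p⁻¹).toReal := by
    refine h2.trans (le_of_eq ?_)
    field_simp
  have h4 := enorm_rpow_le hp (by positivity) hAt h3
  calc Wt p z * ‖radD g z‖ₑ ^ p ≤ Wt p z * (ENNReal.ofReal ((8 / dd z) ^ p) * A) := by gcongr
    _ = ENNReal.ofReal (8 ^ p) * A := by
      rw [← mul_assoc, Wt, ← ENNReal.ofReal_mul (by positivity), ← Real.mul_rpow hd.le (by positivity)]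
      congr 3
      field_simp

theorem easy (n : ℕ) {p : ℝ} (hp : 0 < p) (s : ℝ) : ∃ C : ℝ≥0∞, C ≠ ⊤ ∧ ∀ g : En n → ℂ,
    DifferentiableOn ℂ g (uball n) → Yv p (s + p) (radD g) ≤ C * Yv p s g := by
  obtain ⟨M', C, hC, h⟩ := radD_point n hp
  obtain ⟨C', hC', h'⟩ := fubini_hol n M' (s + ((n : ℝ) + 1))
  refine ⟨C * C', ENNReal.mul_ne_top hC hC', fun g hg => ?_⟩
  rw [Yv_tau, Yv_tau]
  calc ∫⁻ z, Wt (s + p + ((n : ℝ) + 1)) z * ‖radD g z‖ₑ ^ p ∂measTau n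
      ≤ ∫⁻ z, C * (Wt (s + ((n : ℝ) + 1)) z * ∫⁻ u in KD M' z, ‖g u‖ₑ ^ p ∂measTau n)
          ∂measTau n := by
        apply lintegral_mono_ae
        filter_upwards [ae_tau] with z hz
        rw [add_right_comm, Wt_add hz _ p, mul_assoc, mul_left_comm C]
        gcongr Wt _ z * ?_
        exact h g hg z hz
    _ = C * ∫⁻ z, (Wt (s + ((n : ℝ) + 1)) z * ∫⁻ u in KD M' z, ‖g u‖ₑ ^ p ∂measTau n)
          ∂measTau n := lintegral_const_mul' _ _ hC
    _ ≤ _ := by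
        rw [mul_assoc]
        gcongr
        exact h' p g hg

theorem lint_pow {a r : ℝ} (ha : -1 < a) (hr : r < 1) :
    ∫⁻ t in Set.Ioc r 1, ENNReal.ofReal ((t - r) ^ a) =
      ENNReal.ofReal ((1 - r) ^ (a + 1) / (a + 1)) := by
  have h1 : IntervalIntegrable (fun t : ℝ => (t - r) ^ a) volume r 1 := by
    have := (intervalIntegral.intervalIntegrable_rpow' (a := 0) (b := 1 - r) ha).comp_sub_right r
    simpa using this
  have h2 : ∫ t in r..1, (t - r) ^ a = (1 - r) ^ (a + 1) / (a + 1) := by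
    rw [intervalIntegral.integral_comp_sub_right (fun t : ℝ => t ^ a), integral_rpow (Or.inl ha)]
    rw [sub_self, Real.zero_rpow (by linarith), sub_zero]
  rw [← h2, intervalIntegral.integral_of_le hr.le, ofReal_integral_eq_lintegral_ofReal]
  · exact (intervalIntegrable_iff_integrableOn_Ioc_of_le hr.le).1 h1
  · filter_upwards [ae_restrict_mem measurableSet_Ioc] with t ht
    exact Real.rpow_nonneg (by linarith [ht.1]) _

def Wn {n : ℕ} (a : ℝ) (z : En n) : ℝ≥0∞ := (uball n).indicator
  (fun z => ENNReal.ofReal ((1 - ‖z‖) ^ a)) z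

theorem Wn_meas {n : ℕ} (a : ℝ) : Measurable (Wn (n := n) a) := by
  unfold Wn
  apply Measurable.indicator _ (uball_meas n)
  fun_prop

theorem Wn_ne_top {n : ℕ} (a : ℝ) (z : En n) : Wn a z ≠ ⊤ := by
  unfold Wn
  by_cases h : z ∈ uball n <;> simp [h]

theorem Wn_of {n : ℕ} (a : ℝ) {z : En n} (hz : ‖z‖ < 1) :
    Wn a z = ENNReal.ofReal ((1 - ‖z‖) ^ a) := by
  simp [Wn, mem_uball.mpr hz]

theorem Wn_out {n : ℕ} (a : ℝ) {z : En n} (hz : 1 ≤ ‖z‖) : Wn a z = 0 := by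
  have : z ∉ uball n := by rw [mem_uball]; linarith
  simp [Wn, this]

theorem dil_inner {n : ℕ} {a : ℝ} (ha : -1 < a) (w : En n) :
    ∫⁻ t in Set.Icc (1 / 4 : ℝ) 1, Wn a ((t⁻¹ : ℂ) • w) ≤
      ENNReal.ofReal (4 ^ |a| * (a + 1)⁻¹) * Wn (a + 1) w := by
  by_cases hw : ‖w‖ < 1
  · set r := ‖w‖ with hr
    calc ∫⁻ t in Set.Icc (1 / 4 : ℝ) 1, Wn a ((t⁻¹ : ℂ) • w)
        ≤ ∫⁻ t in Set.Icc (1 / 4 : ℝ) 1, ENNReal.ofReal (4 ^ |a|) * (Set.Ioc r 1).indicator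
            (fun t => ENNReal.ofReal ((t - r) ^ a)) t := by
          apply setLIntegral_mono' measurableSet_Icc
          intro t ht
          have ht0 : 0 < t := by linarith [ht.1]
          have hn : ‖(t⁻¹ : ℂ) • w‖ = r / t := by
            rw [norm_smul, norm_inv, Complex.norm_real, Real.norm_of_nonneg ht0.le, ← hr]
            field_simp
          by_cases hrt : r < t
          · have h1 : ‖(t⁻¹ : ℂ) • w‖ < 1 := by rw [hn, div_lt_one ht0]; exact hrt
            rw [Wn_of a h1, Set.indicator_of_mem (Set.mem_Ioc.mpr ⟨hrt, ht.2⟩),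
              ← ENNReal.ofReal_mul (by positivity), hn]
            apply ENNReal.ofReal_le_ofReal
            have e : 1 - r / t = (t - r) / t := by field_simp
            rw [e]
            have h3 : 0 < t - r := by linarith
            apply rpow_cmp (by positivity) h3
            · rw [div_le_iff₀ ht0]
              nlinarith [ht.1]
            · rw [← mul_div_assoc, le_div_iff₀ ht0]
              nlinarith [ht.2]
          · rw [Wn_out a]
            · exact zero_le
            · rw [hn, one_le_div ht0]; linarith
      _ ≤ ∫⁻ t, ENNReal.ofReal (4 ^ |a|) * (Set.Ioc r 1).indicator
            (fun t => ENNReal.ofReal ((t - r) ^ a)) t := setLIntegral_le_lintegral _ _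
      _ = ENNReal.ofReal (4 ^ |a|) * ∫⁻ t in Set.Ioc r 1, ENNReal.ofReal ((t - r) ^ a) := by
          rw [lintegral_const_mul' _ _ ENNReal.ofReal_ne_top, lintegral_indicator measurableSet_Ioc]
      _ = _ := by
          rw [lint_pow ha hw, Wn_of _ hw, ← ENNReal.ofReal_mul (by positivity),
            ← ENNReal.ofReal_mul (by have : 0 < a + 1 := by linarith
                                     positivity), ← hr]
          congr 1
          ring
  · push Not at hw
    have : ∫⁻ t in Set.Icc (1 / 4 : ℝ) 1, Wn a ((t⁻¹ : ℂ) • w) =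
        ∫⁻ t in Set.Icc (1 / 4 : ℝ) 1, 0 := by
      apply setLIntegral_congr_fun measurableSet_Icc
      intro t ht
      have ht0 : 0 < t := by linarith [ht.1]
      simp only
      rw [Wn_out a]
      rw [norm_smul, norm_inv, Complex.norm_real, Real.norm_of_nonneg ht0.le, inv_mul_eq_div,
        one_le_div ht0]
      linarith [ht.2]
    rw [this]; simp

theorem dil (n : ℕ) {a : ℝ} (ha : -1 < a) : ∃ C : ℝ≥0∞, C ≠ ⊤ ∧ ∀ Ψ : En n → ℝ≥0∞,
    Measurable Ψ →
    ∫⁻ z, Wn a z * (∫⁻ t in Set.Icc (1 / 4 : ℝ) 1, Ψ ((t : ℂ) • z)) ∂vol n ≤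
      C * ∫⁻ w, Wn (a + 1) w * Ψ w ∂vol n := by
  set K := ENNReal.ofReal (4 ^ |a| * (a + 1)⁻¹) with hK
  refine ⟨ENNReal.ofReal (16 ^ n) * K, ENNReal.mul_ne_top ENNReal.ofReal_ne_top
    ENNReal.ofReal_ne_top, fun Ψ hΨ => ?_⟩
  have hW := Wn_meas (n := n) a
  calc ∫⁻ z, Wn a z * (∫⁻ t in Set.Icc (1 / 4 : ℝ) 1, Ψ ((t : ℂ) • z)) ∂vol n
      = ∫⁻ z, (∫⁻ t in Set.Icc (1 / 4 : ℝ) 1, Wn a z * Ψ ((t : ℂ) • z)) ∂vol n := by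
        congr 1; ext z; rw [lintegral_const_mul' _ _ (Wn_ne_top a z)]
    _ = ∫⁻ t in Set.Icc (1 / 4 : ℝ) 1, ∫⁻ z, Wn a z * Ψ ((t : ℂ) • z) ∂vol n := by
        apply lintegral_lintegral_swap
        apply Measurable.aemeasurable
        apply Measurable.mul (hW.comp measurable_fst)
        apply hΨ.comp
        fun_prop
    _ ≤ ∫⁻ t in Set.Icc (1 / 4 : ℝ) 1, ENNReal.ofReal (16 ^ n) *
          ∫⁻ w, Wn a ((t⁻¹ : ℂ) • w) * Ψ w ∂vol n := by
        apply setLIntegral_mono' measurableSet_Icc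
        intro t ht
        have ht0 : 0 < t := by linarith [ht.1]
        have htc : (t : ℂ) ≠ 0 := by exact_mod_cast ht0.ne'
        have hdet : LinearMap.det ((t : ℂ) • (LinearMap.id : En n →ₗ[ℂ] En n)) = (t : ℂ) ^ n := by
          rw [LinearMap.det_smul]; simp
        have h1 := lint_lin ((t : ℂ) • (LinearMap.id : En n →ₗ[ℂ] En n))
          (by rw [hdet]; exact pow_ne_zero _ htc) (fun w => Wn a ((t⁻¹ : ℂ) • w) * Ψ w)
          (by apply Measurable.mul _ hΨ
              apply hW.comp; fun_prop)
        rw [← h1, ← mul_assoc, ← ENNReal.ofReal_mul (by positivity), hdet]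
        have h2 : ∀ x : En n, (t⁻¹ : ℂ) • ((t : ℂ) • (LinearMap.id : En n →ₗ[ℂ] En n)) x = x := by
          intro x
          change (t⁻¹ : ℂ) • ((t : ℂ) • x) = x
          rw [smul_smul, inv_mul_cancel₀ htc, one_smul]
        simp only [h2]
        apply le_mul_of_one_le_left zero_le
        rw [ENNReal.one_le_ofReal, norm_pow, Complex.norm_real, Real.norm_of_nonneg ht0.le,
          ← pow_mul, mul_comm n 2, pow_mul, ← mul_pow]
        apply one_le_pow₀
        nlinarith [ht.1]
    _ = ENNReal.ofReal (16 ^ n) * ∫⁻ t in Set.Icc (1 / 4 : ℝ) 1,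
          ∫⁻ w, Wn a ((t⁻¹ : ℂ) • w) * Ψ w ∂vol n :=
        lintegral_const_mul' _ _ ENNReal.ofReal_ne_top
    _ = ENNReal.ofReal (16 ^ n) * ∫⁻ w, (∫⁻ t in Set.Icc (1 / 4 : ℝ) 1,
          Wn a ((t⁻¹ : ℂ) • w) * Ψ w) ∂vol n := by
        congr 1
        apply lintegral_lintegral_swap
        apply Measurable.aemeasurable
        apply Measurable.mul _ (hΨ.comp measurable_snd)
        apply hW.comp
        fun_prop
    _ ≤ ENNReal.ofReal (16 ^ n) * ∫⁻ w, K * (Wn (a + 1) w * Ψ w) ∂vol n := by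
        gcongr with w
        rw [lintegral_mul_const _ (by apply hW.comp; fun_prop), ← mul_assoc]
        gcongr
        exact dil_inner ha w
    _ = _ := by
        rw [lintegral_const_mul' _ _ ENNReal.ofReal_ne_top, mul_assoc]

theorem Wn_fin (n : ℕ) {a : ℝ} (ha : -1 < a) : ∫⁻ z, Wn a z ∂vol n ≠ ⊤ := by
  obtain ⟨C, hC, h⟩ := dil n ha
  have h1 := h (fun _ => 1) measurable_const
  have h2 : ∫⁻ w, Wn (a + 1) w * 1 ∂vol n ≤ vol n (uball n) := by
    rw [← lintegral_indicator_one (uball_meas n)]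
    apply lintegral_mono
    intro w
    beta_reduce
    by_cases hw : ‖w‖ < 1
    · rw [Wn_of _ hw, Set.indicator_of_mem (mem_uball.mpr hw)]
      simp only [mul_one, Pi.one_apply, ENNReal.ofReal_le_one]
      apply Real.rpow_le_one <;> linarith [norm_nonneg w]
    · rw [Wn_out _ (not_lt.mp hw)]; simp
  have h3 : vol n (uball n) ≠ ⊤ := measure_ball_lt_top.ne
  have h4 : ∫⁻ z, Wn a z * (∫⁻ t in Set.Icc (1 / 4 : ℝ) 1, (1 : ℝ≥0∞)) ∂vol n ≠ ⊤ :=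
    ne_top_of_le_ne_top (ENNReal.mul_ne_top hC h3) (h1.trans (by gcongr))
  rw [lintegral_mul_const _ (Wn_meas a)] at h4
  intro h5
  rw [h5, ENNReal.top_mul] at h4
  · exact h4 rfl
  · simp; norm_num

def Hf {n : ℕ} (M p : ℝ) (G : En n → ℂ) (w : En n) : ℝ≥0∞ :=
  ∫⁻ u, {q : En n × En n | ‖q.1‖ < 1 ∧ q.2 ∈ KD M q.1}.indicator
    (fun q => (uball n).indicator (fun w => ‖G w‖ₑ ^ p) q.2) (w, u) ∂measTau n

theorem KDpair_meas (n : ℕ) (M : ℝ) :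
    MeasurableSet {q : En n × En n | ‖q.1‖ < 1 ∧ q.2 ∈ KD M q.1} := by
  apply IsOpen.measurableSet
  have h1 : IsOpen {q : En n × En n | ‖q.1‖ < 1} := isOpen_lt (by fun_prop) (by fun_prop)
  have h2 : IsOpen {q : En n × En n | ‖q.2‖ < 1} := isOpen_lt (by fun_prop) (by fun_prop)
  have h3 : IsOpen {q : En n × En n | ‖1 - inner ℂ q.1 q.2‖ ^ 2 < M * (dd q.1 * dd q.2)} := by
    apply isOpen_lt
    · exact ((continuous_const.sub (continuous_fst.inner continuous_snd)).norm.pow 2)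
    · unfold dd; fun_prop
  exact h1.inter (h2.inter h3)

theorem Hf_meas {n : ℕ} (M p : ℝ) {G : En n → ℂ} (hG : DifferentiableOn ℂ G (uball n)) :
    Measurable (Hf M p G) := by
  unfold Hf
  apply Measurable.lintegral_prod_right' (f := {q : En n × En n | ‖q.1‖ < 1 ∧ q.2 ∈ KD M q.1}.indicator
    (fun q => (uball n).indicator (fun w => ‖G w‖ₑ ^ p) q.2))
  exact ((ind_meas p hG).comp measurable_snd).indicator (KDpair_meas n M)

theorem Hf_eq {n : ℕ} (M p : ℝ) (G : En n → ℂ) {w : En n} (hw : ‖w‖ < 1) :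
    Hf M p G w = ∫⁻ u in KD M w, ‖G u‖ₑ ^ p ∂measTau n := by
  unfold Hf
  rw [← lintegral_indicator (KD_meas M w)]
  apply lintegral_congr
  intro u
  by_cases hu : u ∈ KD M w
  · rw [Set.indicator_of_mem hu, Set.indicator_of_mem (show (w, u) ∈ {q : En n × En n | ‖q.1‖ < 1 ∧ q.2 ∈ KD M q.1} from ⟨hw, hu⟩)]
    simp [KD_sub M w hu]
  · rw [Set.indicator_of_notMem hu, Set.indicator_of_notMem]
    exact fun h => hu h.2

theorem nsm {n : ℕ} (z : En n) {t : ℝ} (ht : 0 ≤ t) : ‖(t : ℂ) • z‖ = t * ‖z‖ := by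
  rw [norm_smul, Complex.norm_real, Real.norm_of_nonneg ht]

theorem hardy_a (n : ℕ) {p : ℝ} (hp : 0 < p) (e : ℝ) : ∃ M : ℝ, ∃ C : ℝ≥0∞, C ≠ ⊤ ∧
    ∀ G : En n → ℂ, DifferentiableOn ℂ G (uball n) → ∀ z : En n, ‖z‖ < 1 →
    ∀ s ∈ Set.Icc (1 / 2 : ℝ) 1,
    ENNReal.ofReal ((1 - s * ‖z‖) ^ (e + 1)) * ‖G ((s : ℂ) • z)‖ₑ ^ p ≤
      C * ∫⁻ t in Set.Icc (1 / 4 : ℝ) 1,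
        ENNReal.ofReal ((1 - ‖(t : ℂ) • z‖) ^ e) * Hf M p G ((t : ℂ) • z) := by
  obtain ⟨M, C0, hC0, hs⟩ := submean_KD' n 4
  refine ⟨M, ENNReal.ofReal (32 * 2 ^ |e|) * C0, ENNReal.mul_ne_top ENNReal.ofReal_ne_top hC0,
    fun G hG z hz s hs1 => ?_⟩
  obtain ⟨hsa, hsb⟩ := hs1
  have hz0 := norm_nonneg z
  set x := 1 - s * ‖z‖ with hx
  have hx0 : 0 < x := by nlinarith
  have hx1 : x ≤ 1 := by nlinarith
  have key : ∀ t ∈ Set.Icc (s - x / 32) s,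
      ENNReal.ofReal (x ^ e) * ‖G ((s : ℂ) • z)‖ₑ ^ p ≤
      ENNReal.ofReal (2 ^ |e|) * C0 *
        (ENNReal.ofReal ((1 - ‖(t : ℂ) • z‖) ^ e) * Hf M p G ((t : ℂ) • z)) := by
    intro t ht
    obtain ⟨hta, htb⟩ := ht
    have ht0 : 1 / 4 < t := by linarith
    have ew : ‖(t : ℂ) • z‖ = t * ‖z‖ := nsm z (by linarith)
    have h1 : x ≤ 1 - t * ‖z‖ := by nlinarith
    have h2 : 1 - t * ‖z‖ ≤ 2 * x := by nlinarith
    have hw : ‖(t : ℂ) • z‖ < 1 := by rw [ew]; linarith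
    have h3 : x ^ e ≤ 2 ^ |e| * (1 - ‖(t : ℂ) • z‖) ^ e := by
      rw [ew]
      apply rpow_cmp hx0 (by linarith) (by linarith) h2
    have hdd : x ≤ dd ((t : ℂ) • z) := by
      unfold dd
      rw [ew]
      nlinarith [mul_nonneg (by linarith : (0 : ℝ) ≤ t) hz0]
    have h4 : (s : ℂ) • z ∈ KD 4 ((t : ℂ) • z) := by
      have e1 : (s : ℂ) • z = ((s / t : ℝ) : ℂ) • ((t : ℂ) • z) := by
        rw [smul_smul, ← Complex.ofReal_mul, div_mul_cancel₀ _ (by linarith : t ≠ 0)]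
      rw [e1]
      apply ray_KD hw
      rw [← Complex.ofReal_one, ← Complex.ofReal_sub, Complex.norm_real, Real.norm_eq_abs]
      have e2 : s / t - 1 = (s - t) / t := by field_simp
      rw [e2, abs_of_nonneg (div_nonneg (by linarith) (by linarith)), div_le_iff₀ (by linarith)]
      nlinarith
    have h5 := hs p hp G hG _ hw _ h4
    rw [← Hf_eq M p G hw] at h5
    calc _ ≤ ENNReal.ofReal (2 ^ |e| * (1 - ‖(t : ℂ) • z‖) ^ e) * (C0 * Hf M p G ((t : ℂ) • z)) := by
          gcongr
      _ = _ := by rw [ENNReal.ofReal_mul (by positivity)]; ring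
  have hsub : Set.Icc (s - x / 32) s ⊆ Set.Icc (1 / 4 : ℝ) 1 := by
    intro t ht
    exact ⟨by linarith [ht.1], by linarith [ht.2]⟩
  have h6 : ∫⁻ t in Set.Icc (s - x / 32) s, ENNReal.ofReal (x ^ e) * ‖G ((s : ℂ) • z)‖ₑ ^ p ≤
      ENNReal.ofReal (2 ^ |e|) * C0 * ∫⁻ t in Set.Icc (1 / 4 : ℝ) 1,
        ENNReal.ofReal ((1 - ‖(t : ℂ) • z‖) ^ e) * Hf M p G ((t : ℂ) • z) := by
    refine (setLIntegral_mono' measurableSet_Icc key).trans ?_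
    rw [lintegral_const_mul' _ _ (ENNReal.mul_ne_top ENNReal.ofReal_ne_top hC0)]
    gcongr
  rw [setLIntegral_const, Real.volume_Icc] at h6
  have e7 : s - (s - x / 32) = x / 32 := by ring
  rw [e7] at h6
  have e8 : ENNReal.ofReal (x ^ (e + 1)) = ENNReal.ofReal 32 * ENNReal.ofReal (x ^ e) *
      ENNReal.ofReal (x / 32) := by
    rw [← ENNReal.ofReal_mul (by positivity), ← ENNReal.ofReal_mul (by positivity),
      Real.rpow_add hx0, Real.rpow_one]
    congr 1; ring
  rw [e8, ENNReal.ofReal_mul (by norm_num : (0 : ℝ) ≤ 32)]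
  calc _ = ENNReal.ofReal 32 * (ENNReal.ofReal (x ^ e) * ‖G ((s : ℂ) • z)‖ₑ ^ p *
        ENNReal.ofReal (x / 32)) := by ring
    _ ≤ _ := by
      refine (mul_le_mul_right h6 _).trans (le_of_eq ?_)
      ring

theorem hardy_b {n : ℕ} {g : En n → ℂ} (hg : DifferentiableOn ℂ g (uball n)) {z : En n}
    (hz : ‖z‖ < 1) {κ B : ℝ} (hκ : 0 < κ) (hB : 0 ≤ B)
    (h : ∀ s ∈ Set.Icc (1 / 2 : ℝ) 1, ‖radD g ((s : ℂ) • z)‖ ≤ B * (1 - s * ‖z‖) ^ (-1 - κ)) :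
    ‖g z - g (((1 / 2 : ℝ) : ℂ) • z)‖ ≤ 2 ^ (2 + κ) / κ * (1 - ‖z‖) ^ (-κ) * B := by
  have hz0 := norm_nonneg z
  set η := 1 - ‖z‖ with hη
  have hη0 : 0 < η := by linarith
  set D : ℝ → ℂ := fun s => fderiv ℂ g ((s : ℂ) • z) z with hD
  have hlt : ∀ s ∈ Set.Icc (1 / 2 : ℝ) 1, ‖(s : ℂ) • z‖ < 1 := by
    intro s hs
    rw [nsm z (by linarith [hs.1])]
    nlinarith [hs.1, hs.2]
  have hder : ∀ s ∈ Set.Icc (1 / 2 : ℝ) 1,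
      HasDerivAt (fun s : ℝ => g ((s : ℂ) • z) - g (((1 / 2 : ℝ) : ℂ) • z)) (D s) s := by
    intro s hs
    exact (ray_deriv hg (hlt s hs)).comp_ofReal.sub_const _
  have hpos : ∀ s ∈ Set.Icc (1 / 2 : ℝ) 1, 0 < η + 1 - s := by
    intro s hs; linarith [hs.2]
  have hbder : ∀ s ∈ Set.Icc (1 / 2 : ℝ) 1,
      HasDerivAt (fun s : ℝ => 2 ^ (2 + κ) / κ * (η + 1 - s) ^ (-κ) * B)
        (2 ^ (2 + κ) * B * (η + 1 - s) ^ (-1 - κ)) s := by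
    intro s hs
    have h1 : HasDerivAt (fun s : ℝ => η + 1 - s) (-1) s := by
      simpa using (hasDerivAt_id s).const_sub (η + 1)
    have h2 := ((h1.rpow_const (p := -κ) (Or.inl (hpos s hs).ne')).const_mul
      (2 ^ (2 + κ) / κ)).mul_const B
    have e : 2 ^ (2 + κ) * B * (η + 1 - s) ^ (-1 - κ) =
        2 ^ (2 + κ) / κ * (-1 * -κ * (η + 1 - s) ^ (-κ - 1)) * B := by
      rw [show -κ - 1 = -1 - κ by ring]
      field_simp
    rw [e]
    exact h2
  have hD2 : ∀ s ∈ Set.Icc (1 / 2 : ℝ) 1, ‖D s‖ ≤ 2 ^ (2 + κ) * B * (η + 1 - s) ^ (-1 - κ) := by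
    intro s hs
    have h1 := h s hs
    have h2 : radD g ((s : ℂ) • z) = (s : ℂ) * D s := by simp [radD, hD]
    rw [h2, norm_mul, Complex.norm_real, Real.norm_of_nonneg (by linarith [hs.1])] at h1
    have h3 : ‖D s‖ ≤ 2 * (B * (1 - s * ‖z‖) ^ (-1 - κ)) := by
      nlinarith [hs.1, norm_nonneg (D s)]
    have h4 : (1 - s * ‖z‖) ^ (-1 - κ) ≤ ((η + 1 - s) / 2) ^ (-1 - κ) := by
      apply Real.rpow_le_rpow_of_nonpos
      · linarith [hpos s hs]
      · have := hs.1
        have := hs.2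
        nlinarith
      · linarith
    have h5 : ((η + 1 - s) / 2) ^ (-1 - κ) = 2 ^ (1 + κ) * (η + 1 - s) ^ (-1 - κ) := by
      rw [Real.div_rpow (hpos s hs).le (by norm_num), show -1 - κ = -(1 + κ) by ring,
        Real.rpow_neg (by norm_num : (0 : ℝ) ≤ 2)]
      field_simp
    rw [h5] at h4
    have h6 : (2 : ℝ) ^ (2 + κ) = 2 * 2 ^ (1 + κ) := by
      rw [show 2 + κ = 1 + (1 + κ) by ring, Real.rpow_add (by norm_num), Real.rpow_one]
    rw [h6]
    calc ‖D s‖ ≤ _ := h3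
      _ ≤ 2 * (B * (2 ^ (1 + κ) * (η + 1 - s) ^ (-1 - κ))) := by gcongr
      _ = _ := by ring
  have hsub : Set.Ico (1 / 2 : ℝ) 1 ⊆ Set.Icc (1 / 2 : ℝ) 1 := Set.Ico_subset_Icc_self
  have := image_norm_le_of_norm_deriv_right_le_deriv_boundary' (a := (1 / 2 : ℝ)) (b := 1)
    (fun s hs => (hder s hs).continuousAt.continuousWithinAt)
    (fun s hs => (hder s (hsub hs)).hasDerivWithinAt)
    (by
      simp only [sub_self, norm_zero]
      have := hpos (1 / 2) ⟨le_refl _, by norm_num⟩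
      positivity)
    (fun s hs => (hbder s hs).continuousAt.continuousWithinAt)
    (fun s hs => (hbder s (hsub hs)).hasDerivWithinAt)
    (fun s hs => hD2 s (hsub hs)) (x := 1) ⟨by norm_num, le_refl _⟩
  simpa using this

/-- pointwise bound combining `hardy_a` and `hardy_b` -/
theorem hardy_c (n : ℕ) {p ε : ℝ} (hp : 0 < p) (hε : 0 < ε) : ∃ M : ℝ, ∃ C : ℝ≥0∞, C ≠ ⊤ ∧
    ∀ g : En n → ℂ, DifferentiableOn ℂ g (uball n) → ∀ z : En n, ‖z‖ < 1 →
    ENNReal.ofReal ((1 - ‖z‖) ^ ε) * ‖g z - g (((1 / 2 : ℝ) : ℂ) • z)‖ₑ ^ p ≤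
      C * ∫⁻ t in Set.Icc (1 / 4 : ℝ) 1,
        ENNReal.ofReal ((1 - ‖(t : ℂ) • z‖) ^ (p - 1 + ε)) * Hf M p (radD g) ((t : ℂ) • z) := by
  obtain ⟨M, C, hC, h⟩ := hardy_a n hp (p - 1 + ε)
  set κ := ε / p with hκ
  have hκ0 : 0 < κ := by positivity
  set c : ℝ := 2 ^ (2 + κ) / κ with hc
  have hc0 : 0 < c := by positivity
  refine ⟨M, ENNReal.ofReal (c ^ p) * (C + 1), ENNReal.mul_ne_top ENNReal.ofReal_ne_top
    (by simp [hC]), fun g hg z hz => ?_⟩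
  have h1 := h _ (radD_diff hg) z hz
  set J := ∫⁻ t in Set.Icc (1 / 4 : ℝ) 1,
        ENNReal.ofReal ((1 - ‖(t : ℂ) • z‖) ^ (p - 1 + ε)) * Hf M p (radD g) ((t : ℂ) • z) with hJ
  by_cases hJt : J = ⊤
  · rw [hJt, ENNReal.mul_top]
    · exact le_top
    · have : 0 < ENNReal.ofReal (c ^ p) := by rw [ENNReal.ofReal_pos]; positivity
      simp [this.ne']
  have hA : C * J ≠ ⊤ := ENNReal.mul_ne_top hC hJt
  set B := ((C * J) ^ p⁻¹).toReal with hB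
  have hB0 : 0 ≤ B := ENNReal.toReal_nonneg
  have hz0 := norm_nonneg z
  have h2 : ∀ s ∈ Set.Icc (1 / 2 : ℝ) 1, ‖radD g ((s : ℂ) • z)‖ ≤ B * (1 - s * ‖z‖) ^ (-1 - κ) := by
    intro s hs
    have hx0 : 0 < 1 - s * ‖z‖ := by nlinarith [hs.1, hs.2]
    have h3 := h1 s hs
    have hy0 : 0 < (1 - s * ‖z‖) ^ (1 + κ) := by positivity
    have e1 : ENNReal.ofReal ((1 - s * ‖z‖) ^ (p - 1 + ε + 1)) * ‖radD g ((s : ℂ) • z)‖ₑ ^ p =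
        ‖(((1 - s * ‖z‖) ^ (1 + κ) : ℝ) : ℂ) * radD g ((s : ℂ) • z)‖ₑ ^ p := by
      rw [enorm_mul, ENNReal.mul_rpow_of_nonneg _ _ hp.le]
      congr 1
      rw [← ofReal_norm, Complex.norm_real, Real.norm_of_nonneg hy0.le,
        ENNReal.ofReal_rpow_of_nonneg hy0.le hp.le, ← Real.rpow_mul hx0.le]
      congr 2
      rw [hκ]; field_simp; ring
    rw [e1] at h3
    have h4 := enorm_le_of_rpow hp hA h3
    rw [norm_mul, Complex.norm_real, Real.norm_of_nonneg hy0.le] at h4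
    rw [show -1 - κ = -(1 + κ) by ring, Real.rpow_neg hx0.le, ← div_eq_mul_inv, le_div_iff₀ hy0]
    linarith
  have h5 := hardy_b hg hz hκ0 hB0 h2
  have hη : 0 < 1 - ‖z‖ := by linarith
  have e2 : ENNReal.ofReal ((1 - ‖z‖) ^ ε) * ‖g z - g (((1 / 2 : ℝ) : ℂ) • z)‖ₑ ^ p =
      ‖(((1 - ‖z‖) ^ κ : ℝ) : ℂ) * (g z - g (((1 / 2 : ℝ) : ℂ) • z))‖ₑ ^ p := by
    rw [enorm_mul, ENNReal.mul_rpow_of_nonneg _ _ hp.le]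
    congr 1
    rw [← ofReal_norm, Complex.norm_real, Real.norm_of_nonneg (by positivity),
      ENNReal.ofReal_rpow_of_nonneg (by positivity) hp.le, ← Real.rpow_mul hη.le]
    congr 2
    rw [hκ]; field_simp
  rw [e2, mul_assoc]
  refine (enorm_rpow_le hp hc0.le hA ?_).trans ?_
  · rw [norm_mul, Complex.norm_real, Real.norm_of_nonneg (by positivity)]
    calc _ ≤ (1 - ‖z‖) ^ κ * (c * (1 - ‖z‖) ^ (-κ) * B) := by gcongr
      _ = c * B * ((1 - ‖z‖) ^ κ * (1 - ‖z‖) ^ (-κ)) := by ring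
      _ = c * B := by rw [← Real.rpow_add hη]; simp
  · gcongr
    exact le_self_add

theorem dd_cmp {n : ℕ} {z : En n} (hz : ‖z‖ < 1) : 1 - ‖z‖ ≤ 2 * dd z ∧ dd z ≤ 2 * (1 - ‖z‖) := by
  have := norm_nonneg z
  unfold dd
  constructor <;> nlinarith

theorem Wt_Wn {n : ℕ} {z : En n} (hz : ‖z‖ < 1) (s : ℝ) :
    Wt s z ≤ ENNReal.ofReal (2 ^ |s|) * ENNReal.ofReal ((1 - ‖z‖) ^ s) := by
  unfold Wt
  rw [← ENNReal.ofReal_mul (by positivity)]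
  apply ENNReal.ofReal_le_ofReal
  exact rpow_cmp (dd_pos hz) (by linarith) (dd_cmp hz).2 (dd_cmp hz).1 s

theorem Wn_Wt {n : ℕ} {z : En n} (hz : ‖z‖ < 1) (s : ℝ) :
    ENNReal.ofReal ((1 - ‖z‖) ^ s) ≤ ENNReal.ofReal (2 ^ |s|) * Wt s z := by
  unfold Wt
  rw [← ENNReal.ofReal_mul (by positivity)]
  apply ENNReal.ofReal_le_ofReal
  exact rpow_cmp (by linarith) (dd_pos hz) (dd_cmp hz).1 (dd_cmp hz).2 s

theorem hardy_d (n : ℕ) {p β : ℝ} (hp : 0 < p) (hβ : -1 < β) : ∃ C : ℝ≥0∞, C ≠ ⊤ ∧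
    ∀ g : En n → ℂ, DifferentiableOn ℂ g (uball n) →
    ∫⁻ z in uball n, Wt β z * ‖g z - g (((1 / 2 : ℝ) : ℂ) • z)‖ₑ ^ p ∂vol n ≤
      C * Yv p (β + p) (radD g) := by
  set ε := (β + 1) / 2 with hε
  have hε0 : 0 < ε := by rw [hε]; linarith
  obtain ⟨M, C1, hC1, h1⟩ := hardy_c n hp hε0
  obtain ⟨C2, hC2, h2⟩ := dil n (a := β - ε) (by rw [hε]; linarith)
  obtain ⟨C3, hC3, h3⟩ := fubini_hol n M (β + p + ((n : ℝ) + 1))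
  set K := ENNReal.ofReal (2 ^ |β|) with hK
  set K' := ENNReal.ofReal (2 ^ |β + p|) with hK'
  have hKC : K * C1 ≠ ⊤ := ENNReal.mul_ne_top ENNReal.ofReal_ne_top hC1
  refine ⟨K * C1 * (C2 * (K' * C3)), ENNReal.mul_ne_top hKC (ENNReal.mul_ne_top hC2
    (ENNReal.mul_ne_top ENNReal.ofReal_ne_top hC3)), fun g hg => ?_⟩
  have hR := radD_diff hg
  set Ψ : En n → ℝ≥0∞ := fun w => ENNReal.ofReal ((1 - ‖w‖) ^ (p - 1 + ε)) * Hf M p (radD g) w with hΨ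
  have hΨm : Measurable Ψ := by
    apply Measurable.mul _ (Hf_meas M p hR)
    fun_prop
  have s1 : ∫⁻ z in uball n, Wt β z * ‖g z - g (((1 / 2 : ℝ) : ℂ) • z)‖ₑ ^ p ∂vol n ≤
      K * C1 * ∫⁻ z, Wn (β - ε) z * (∫⁻ t in Set.Icc (1 / 4 : ℝ) 1, Ψ ((t : ℂ) • z)) ∂vol n := by
    rw [← lintegral_const_mul' _ _ hKC]
    refine le_trans ?_ (setLIntegral_le_lintegral (uball n) _)
    apply setLIntegral_mono' (uball_meas n)
    intro z hz
    rw [mem_uball] at hz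
    have hη : 0 < 1 - ‖z‖ := by linarith
    rw [Wn_of _ hz]
    calc Wt β z * ‖g z - g (((1 / 2 : ℝ) : ℂ) • z)‖ₑ ^ p
        ≤ (K * ENNReal.ofReal ((1 - ‖z‖) ^ β)) * ‖g z - g (((1 / 2 : ℝ) : ℂ) • z)‖ₑ ^ p := by
          gcongr; exact Wt_Wn hz β
      _ = K * ENNReal.ofReal ((1 - ‖z‖) ^ (β - ε)) * (ENNReal.ofReal ((1 - ‖z‖) ^ ε) *
            ‖g z - g (((1 / 2 : ℝ) : ℂ) • z)‖ₑ ^ p) := by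
          have : ENNReal.ofReal ((1 - ‖z‖) ^ β) = ENNReal.ofReal ((1 - ‖z‖) ^ (β - ε)) *
              ENNReal.ofReal ((1 - ‖z‖) ^ ε) := by
            rw [← ENNReal.ofReal_mul (by positivity), ← Real.rpow_add hη]; simp
          rw [this]; ring
      _ ≤ K * ENNReal.ofReal ((1 - ‖z‖) ^ (β - ε)) *
            (C1 * (∫⁻ t in Set.Icc (1 / 4 : ℝ) 1, Ψ ((t : ℂ) • z))) := by
          exact mul_le_mul_right (h1 g hg z hz) _
      _ = _ := by ring
  have s2 : ∫⁻ w, Wn (β - ε + 1) w * Ψ w ∂vol n ≤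
      K' * ∫⁻ w in uball n, Wt (β + p) w * Hf M p (radD g) w ∂vol n := by
    rw [← lintegral_const_mul' _ _ ENNReal.ofReal_ne_top, ← lintegral_indicator (uball_meas n)]
    apply lintegral_mono
    intro w
    by_cases hw : ‖w‖ < 1
    · have hη : 0 < 1 - ‖w‖ := by linarith
      simp only [hΨ]
      rw [Set.indicator_of_mem (mem_uball.mpr hw), Wn_of _ hw, ← mul_assoc,
        ← ENNReal.ofReal_mul (by positivity), ← Real.rpow_add hη,
        show β - ε + 1 + (p - 1 + ε) = β + p by ring, ← mul_assoc]
      gcongr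
      exact Wn_Wt hw _
    · simp only [Wn_out _ (not_lt.mp hw), zero_mul]; exact zero_le
  have s3 : ∫⁻ w in uball n, Wt (β + p) w * Hf M p (radD g) w ∂vol n ≤
      C3 * Yv p (β + p) (radD g) := by
    rw [Yv_tau]
    refine le_trans (le_of_eq ?_) (h3 p _ hR)
    rw [lint_vol]
    apply lintegral_congr_ae
    filter_upwards [ae_tau] with z hz
    rw [← mul_assoc, ← Wt_add hz, add_comm ((n : ℝ) + 1), Hf_eq M p _ hz]
  calc _ ≤ _ := s1
    _ ≤ K * C1 * (C2 * (K' * (C3 * Yv p (β + p) (radD g)))) := by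
      gcongr
      exact (h2 Ψ hΨm).trans (mul_le_mul_right (s2.trans (mul_le_mul_right s3 _)) _)
    _ = _ := by ring

/-- central part -/
theorem central_a {n : ℕ} {g : En n → ℂ} (hg : DifferentiableOn ℂ g (uball n)) {B : ℝ}
    (h : ∀ w : En n, ‖w‖ ≤ 1 / 2 → ‖radD g w‖ ≤ B) {y : En n} (hy : ‖y‖ ≤ 1 / 2) :
    ‖g y - g 0‖ ≤ B := by
  have hl2 : ∀ l : ℂ, ‖l‖ < 2 → ‖l • y‖ < 1 := by
    intro l hl
    rw [norm_smul]
    nlinarith [norm_nonneg l, norm_nonneg y]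
  have hu : DifferentiableOn ℂ (fun l : ℂ => g (l • y)) (Metric.ball 0 2) := by
    intro l hl
    rw [mem_ball_zero_iff] at hl
    exact (ray_deriv hg (hl2 l hl)).differentiableAt.differentiableWithinAt
  have hdu := hu.deriv Metric.isOpen_ball
  have hb : ∀ l ∈ Metric.closedBall (0 : ℂ) 1, ‖deriv (fun l : ℂ => g (l • y)) l‖ ≤ B := by
    intro l hl
    have hc : closure (Metric.ball (0 : ℂ) 1) = Metric.closedBall 0 1 := closure_ball _ one_ne_zero
    refine Complex.norm_le_of_forall_mem_frontier_norm_le (U := Metric.ball (0 : ℂ) 1)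
      Metric.isBounded_ball ?_ ?_ (by rw [hc]; exact hl)
    · apply DifferentiableOn.diffContOnCl
      rw [hc]
      exact hdu.mono (Metric.closedBall_subset_ball (by norm_num))
    · intro l hl
      rw [frontier_ball _ one_ne_zero, mem_sphere_zero_iff_norm] at hl
      rw [(ray_deriv hg (hl2 l (by linarith))).deriv]
      have e : radD g (l • y) = l * fderiv ℂ g (l • y) y := by simp [radD]
      have h1 := h (l • y) (by rw [norm_smul, hl, one_mul]; exact hy)
      rwa [e, norm_mul, hl, one_mul] at h1
  have := (convex_closedBall (0 : ℂ) 1).norm_image_sub_le_of_norm_deriv_le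
    (f := fun l : ℂ => g (l • y)) (fun l hl => by
      rw [mem_closedBall_zero_iff] at hl
      exact (ray_deriv hg (hl2 l (by linarith))).differentiableAt) hb
    (x := 0) (y := 1) (by simp) (by simp)
  simpa using this

theorem central_b (n : ℕ) {p : ℝ} (hp : 0 < p) (s : ℝ) : ∃ C : ℝ≥0∞, C ≠ ⊤ ∧
    ∀ g : En n → ℂ, DifferentiableOn ℂ g (uball n) → ∀ y : En n, ‖y‖ ≤ 1 / 2 →
    ‖g y - g 0‖ₑ ^ p ≤ C * Yv p s (radD g) := by
  obtain ⟨M, C0, hC0, hs⟩ := submean_KD' n 4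
  set K := ENNReal.ofReal ((4 * M) ^ |s + ((n : ℝ) + 1)|) with hK
  refine ⟨C0 * K + 1, by simp [hK, ENNReal.mul_eq_top, hC0], fun g hg y hy => ?_⟩
  by_cases hY : Yv p s (radD g) = ⊤
  · rw [hY, ENNReal.mul_top (by simp)]; exact le_top
  have h1 : ∀ w : En n, ‖w‖ ≤ 1 / 2 → ‖radD g w‖ₑ ^ p ≤ C0 * K * Yv p s (radD g) := by
    intro w hw
    have hw4 : w ∈ KD 4 (0 : En n) := by
      refine ⟨by linarith, ?_⟩
      simp only [inner_zero_left, sub_zero, norm_one, dd, norm_zero]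
      nlinarith [norm_nonneg w]
    refine (hs p hp _ (radD_diff hg) 0 (by simp) w hw4).trans ?_
    rw [mul_assoc, Yv_tau, ← lintegral_const_mul' _ _ ENNReal.ofReal_ne_top]
    refine mul_le_mul_right ?_ _
    refine le_trans ?_ (setLIntegral_le_lintegral (KD M 0) _)
    apply setLIntegral_mono' (KD_meas M 0)
    intro u hu
    have := Wt_cmp' (by simp) hu (s + ((n : ℝ) + 1))
    have e : Wt (s + ((n : ℝ) + 1)) (0 : En n) = 1 := by simp [Wt, dd]
    rw [e] at this
    rw [← mul_assoc]
    calc _ = 1 * ‖radD g u‖ₑ ^ p := by rw [one_mul]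
      _ ≤ _ := by gcongr
  have hA : C0 * K * Yv p s (radD g) ≠ ⊤ :=
    ENNReal.mul_ne_top (ENNReal.mul_ne_top hC0 ENNReal.ofReal_ne_top) hY
  have h2 := central_a hg (fun w hw => enorm_le_of_rpow hp hA (h1 w hw)) hy
  have h3 := enorm_rpow_le (c := 1) hp (by norm_num) hA (by simpa using h2)
  refine h3.trans ?_
  simp only [Real.one_rpow, ENNReal.ofReal_one, one_mul]
  gcongr
  exact le_self_add

theorem Wt_fin (n : ℕ) {β : ℝ} (hβ : -1 < β) : ∫⁻ z in uball n, Wt β z ∂vol n ≠ ⊤ := by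
  have h : ∫⁻ z in uball n, Wt β z ∂vol n ≤ ENNReal.ofReal (2 ^ |β|) * ∫⁻ z, Wn β z ∂vol n := by
    rw [← lintegral_const_mul' _ _ ENNReal.ofReal_ne_top]
    refine le_trans ?_ (setLIntegral_le_lintegral (uball n) _)
    apply setLIntegral_mono' (uball_meas n)
    intro z hz
    rw [mem_uball] at hz
    rw [Wn_of _ hz]
    exact Wt_Wn hz β
  exact ne_top_of_le_ne_top (ENNReal.mul_ne_top ENNReal.ofReal_ne_top (Wn_fin n hβ)) h

theorem add3 (x y w : ℝ≥0∞) {p : ℝ} (hp : 0 < p) :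
    (x + y + w) ^ p ≤ ENNReal.ofReal (3 ^ p) * (x ^ p + y ^ p + w ^ p) := by
  set m := max x (max y w) with hm
  have h1 : x + y + w ≤ 3 * m := by
    have hx : x ≤ m := le_max_left _ _
    have hy : y ≤ m := (le_max_left _ _).trans (le_max_right _ _)
    have hw : w ≤ m := (le_max_right _ _).trans (le_max_right _ _)
    calc x + y + w ≤ m + m + m := by gcongr
      _ = 3 * m := by ring
  have h2 : m ^ p ≤ x ^ p + y ^ p + w ^ p := by
    rcases max_choice x (max y w) with h | h
    · rw [hm, h, add_assoc]; exact le_self_add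
    · rcases max_choice y w with h' | h'
      · rw [hm, h, h', add_assoc]; exact le_self_add.trans le_add_self
      · rw [hm, h, h']; exact le_add_self
  calc (x + y + w) ^ p ≤ (3 * m) ^ p := by gcongr
    _ = ENNReal.ofReal (3 ^ p) * m ^ p := by
      rw [ENNReal.mul_rpow_of_nonneg _ _ hp.le, ← ENNReal.ofReal_rpow_of_nonneg (by norm_num) hp.le]
      simp
    _ ≤ _ := by gcongr

theorem hardy (n : ℕ) {p β : ℝ} (hp : 0 < p) (hβ : -1 < β) : ∃ C : ℝ≥0∞, C ≠ ⊤ ∧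
    ∀ g : En n → ℂ, DifferentiableOn ℂ g (uball n) →
      Yv p β g ≤ C * (‖g 0‖ₑ ^ p + Yv p (β + p) (radD g)) := by
  obtain ⟨C1, hC1, h1⟩ := hardy_d n hp hβ
  obtain ⟨C2, hC2, h2⟩ := central_b n hp (β + p)
  have hV := Wt_fin n hβ
  set V := ∫⁻ z in uball n, Wt β z ∂vol n with hVd
  set K := ENNReal.ofReal (3 ^ p) with hK
  refine ⟨K * (C1 + C2 * V + V), ?_, fun g hg => ?_⟩
  · exact ENNReal.mul_ne_top ENNReal.ofReal_ne_top (by simp [hC1, hV, ENNReal.mul_eq_top, hC2])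
  set Y := Yv p (β + p) (radD g) with hY
  have pt : ∀ z ∈ uball n, Wt β z * ‖g z‖ₑ ^ p ≤
      K * (Wt β z * ‖g z - g (((1 / 2 : ℝ) : ℂ) • z)‖ₑ ^ p + Wt β z * (C2 * Y + ‖g 0‖ₑ ^ p)) := by
    intro z hz
    rw [mem_uball] at hz
    have hy : ‖((1 / 2 : ℝ) : ℂ) • z‖ ≤ 1 / 2 := by
      rw [nsm z (by norm_num)]; linarith
    have h3 : ‖g z‖ₑ ≤ ‖g z - g (((1 / 2 : ℝ) : ℂ) • z)‖ₑ + ‖g (((1 / 2 : ℝ) : ℂ) • z) - g 0‖ₑ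
        + ‖g 0‖ₑ := by
      have e : g z = (g z - g (((1 / 2 : ℝ) : ℂ) • z)) + (g (((1 / 2 : ℝ) : ℂ) • z) - g 0) + g 0 := by
        ring
      conv_lhs => rw [e]
      exact (enorm_add_le _ _).trans (add_le_add_left (enorm_add_le _ _) _)
    have h4 : ‖g z‖ₑ ^ p ≤ K * (‖g z - g (((1 / 2 : ℝ) : ℂ) • z)‖ₑ ^ p + C2 * Y + ‖g 0‖ₑ ^ p) := by
      calc _ ≤ _ := ENNReal.rpow_le_rpow h3 hp.le
        _ ≤ _ := add3 _ _ _ hp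
        _ ≤ _ := by gcongr; exact h2 g hg _ hy
    calc _ ≤ Wt β z * _ := mul_le_mul_right h4 _
      _ = _ := by ring
  calc Yv p β g ≤ _ := setLIntegral_mono' (uball_meas n) pt
    _ = K * ((∫⁻ z in uball n, Wt β z * ‖g z - g (((1 / 2 : ℝ) : ℂ) • z)‖ₑ ^ p ∂vol n) +
          V * (C2 * Y + ‖g 0‖ₑ ^ p)) := by
      rw [lintegral_const_mul' _ _ ENNReal.ofReal_ne_top, lintegral_add_right,
        lintegral_mul_const _ (Wt_meas β)]
      exact (Wt_meas β).mul_const _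
    _ ≤ K * (C1 * Y + V * (C2 * Y + ‖g 0‖ₑ ^ p)) := by
      gcongr; exact h1 g hg
    _ = K * ((C1 + C2 * V) * Y + V * ‖g 0‖ₑ ^ p) := by ring
    _ ≤ K * ((C1 + C2 * V + V) * Y + (C1 + C2 * V + V) * ‖g 0‖ₑ ^ p) := by
      exact mul_le_mul_right (add_le_add (mul_le_mul_left le_self_add _)
        (mul_le_mul_left le_add_self _)) _
    _ = _ := by ring

theorem easy_it (n : ℕ) {p : ℝ} (hp : 0 < p) (α : ℝ) (N m : ℕ) : ∃ C : ℝ≥0∞, C ≠ ⊤ ∧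
    ∀ f : En n → ℂ, DifferentiableOn ℂ f (uball n) →
      Yv p (α + p * ((N + m : ℕ) : ℝ)) (radIter (N + m) f) ≤
        C * Yv p (α + p * N) (radIter N f) := by
  induction m with
  | zero => exact ⟨1, by simp, fun f hf => by simp⟩
  | succ m ih =>
    obtain ⟨C, hC, h⟩ := ih
    obtain ⟨C', hC', h'⟩ := easy n hp (α + p * ((N + m : ℕ) : ℝ))
    refine ⟨C' * C, ENNReal.mul_ne_top hC' hC, fun f hf => ?_⟩
    have h1 := h' _ (radIter_diff hf (N + m))
    have e : α + p * ((N + (m + 1) : ℕ) : ℝ) = α + p * ((N + m : ℕ) : ℝ) + p := by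
      push_cast; ring
    rw [e, mul_assoc]
    exact h1.trans (mul_le_mul_right (h f hf) _)

theorem radIter_at_zero {n : ℕ} (f : En n → ℂ) {p : ℝ} (hp : 0 < p) (j : ℕ) :
    ‖radIter j f 0‖ₑ ^ p ≤ ‖f 0‖ₑ ^ p := by
  cases j with
  | zero => exact le_rfl
  | succ j =>
    have : radIter (j + 1) f 0 = 0 := radD_zero _
    rw [this, enorm_zero, ENNReal.zero_rpow_of_pos hp]
    exact zero_le

theorem hardy_it (n : ℕ) {p : ℝ} (hp : 0 < p) (α : ℝ) (N : ℕ) (hN : -1 < α + p * N) (m : ℕ) :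
    ∃ C : ℝ≥0∞, C ≠ ⊤ ∧
    ∀ f : En n → ℂ, DifferentiableOn ℂ f (uball n) →
      Yv p (α + p * N) (radIter N f) ≤
        C * (‖f 0‖ₑ ^ p + Yv p (α + p * ((N + m : ℕ) : ℝ)) (radIter (N + m) f)) := by
  induction m with
  | zero => exact ⟨1, by simp, fun f hf => by simp⟩
  | succ m ih =>
    obtain ⟨C, hC, h⟩ := ih
    have hb : -1 < α + p * ((N + m : ℕ) : ℝ) := by
      push_cast
      nlinarith [mul_nonneg hp.le (Nat.cast_nonneg (α := ℝ) m)]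
    obtain ⟨C', hC', h'⟩ := hardy n hp hb
    refine ⟨C * (1 + C'), ENNReal.mul_ne_top hC (by simp [hC']), fun f hf => ?_⟩
    have h1 := h' _ (radIter_diff hf (N + m))
    have e : α + p * ((N + (m + 1) : ℕ) : ℝ) = α + p * ((N + m : ℕ) : ℝ) + p := by
      push_cast; ring
    rw [e, mul_assoc]
    refine (h f hf).trans (mul_le_mul_right ?_ _)
    change _ ≤ (1 + C') * (‖f 0‖ₑ ^ p + Yv p (α + p * ((N + m : ℕ) : ℝ) + p)
      (radD (radIter (N + m) f)))
    have h2 := radIter_at_zero f hp (N + m)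
    rw [add_mul, one_mul]
    exact add_le_add le_self_add (h1.trans (mul_le_mul_right (add_le_add h2 le_rfl) _))

theorem fin_alg {p : ℝ} (hp : 0 < p) {D c : ℝ≥0∞} (hD : D ≠ ⊤) (hc : c ≠ ⊤) :
    ∃ C : ℝ≥0∞, 0 < C ∧ C < ⊤ ∧ ∀ F A T : ℝ≥0∞, F ≠ ⊤ → A ≤ D * T → T ≤ D * (c * F ^ p + A) →
      ((F + T ^ (1 / p) < ⊤ ↔ A < ⊤) ∧ C⁻¹ * (F + A ^ (1 / p)) ≤ F + T ^ (1 / p) ∧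
        F + T ^ (1 / p) ≤ C * (F + A ^ (1 / p))) := by
  have hp1 : 0 < 1 / p := by positivity
  set r := 1 / p with hr
  set K := ENNReal.ofReal (3 ^ r) with hK
  have t1 : D ^ r ≠ ⊤ := ENNReal.rpow_ne_top_of_nonneg hp1.le hD
  have t2 : (D * c) ^ r ≠ ⊤ := ENNReal.rpow_ne_top_of_nonneg hp1.le (ENNReal.mul_ne_top hD hc)
  have t3 : K ≠ ⊤ := ENNReal.ofReal_ne_top
  set C := 1 + D ^ r + K * (D * c) ^ r + K * D ^ r with hC
  have hCt : C ≠ ⊤ := by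
    simp [hC, ENNReal.mul_eq_top, t1, t2, t3]
  have hC1 : 1 ≤ C := by
    rw [hC, add_assoc, add_assoc]; exact le_self_add
  have hC0 : 0 < C := lt_of_lt_of_le one_pos hC1
  refine ⟨C, hC0, hCt.lt_top, fun F A T hF h1 h2 => ?_⟩
  have a1 : F + A ^ r ≤ C * (F + T ^ r) := by
    have : A ^ r ≤ D ^ r * T ^ r := by
      rw [← ENNReal.mul_rpow_of_nonneg _ _ hp1.le]
      exact ENNReal.rpow_le_rpow h1 hp1.le
    have hDC : D ^ r ≤ C := by
      rw [hC, add_assoc, add_comm 1, add_assoc]; exact le_self_add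
    calc F + A ^ r ≤ 1 * F + D ^ r * T ^ r := by rw [one_mul]; gcongr
      _ ≤ C * F + C * T ^ r := by gcongr
      _ = _ := by ring
  have a2 : F + T ^ r ≤ C * (F + A ^ r) := by
    have b1 : T ^ r ≤ K * ((D * c) ^ r * F + D ^ r * A ^ r) := by
      calc T ^ r ≤ (D * c * F ^ p + D * A + 0) ^ r := by
            apply ENNReal.rpow_le_rpow _ hp1.le
            refine h2.trans (le_of_eq ?_); ring
        _ ≤ _ := add3 _ _ _ hp1
        _ = _ := by
          rw [ENNReal.zero_rpow_of_pos hp1, add_zero, ENNReal.mul_rpow_of_nonneg _ _ hp1.le,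
            ENNReal.mul_rpow_of_nonneg D A hp1.le, ← ENNReal.rpow_mul, hr,
            mul_one_div_cancel hp.ne', ENNReal.rpow_one]
    calc F + T ^ r ≤ F + K * ((D * c) ^ r * F + D ^ r * A ^ r) := by gcongr
      _ = (1 + K * (D * c) ^ r) * F + K * D ^ r * A ^ r := by ring
      _ ≤ C * F + C * A ^ r := by
        have c1 : 1 + K * (D * c) ^ r ≤ C := by
          rw [hC, add_right_comm 1 (D ^ r), add_assoc]; exact le_self_add
        have c2 : K * D ^ r ≤ C := by rw [hC]; exact le_add_self
        gcongr
      _ = _ := by ring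
  refine ⟨⟨fun h => ?_, fun h => ?_⟩, ?_, a2⟩
  · have h3 : F + A ^ r < ⊤ := lt_of_le_of_lt a1 (ENNReal.mul_lt_top hCt.lt_top h)
    have h4 : A ^ r < ⊤ := lt_of_le_of_lt le_add_self h3
    by_contra h5
    rw [not_lt, top_le_iff] at h5
    rw [h5, ENNReal.top_rpow_of_pos hp1] at h4
    exact lt_irrefl _ h4
  · refine lt_of_le_of_lt a2 (ENNReal.mul_lt_top hCt.lt_top ?_)
    exact ENNReal.add_lt_top.mpr ⟨hF.lt_top, ENNReal.rpow_lt_top_of_nonneg hp1.le h.ne⟩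
  · calc C⁻¹ * (F + A ^ r) ≤ C⁻¹ * (C * (F + T ^ r)) := by gcongr
      _ = F + T ^ r := by rw [← mul_assoc, ENNReal.inv_mul_cancel hC0.ne' hCt, one_mul]


/-- Area integral characterization of the generalized Bergman spaces:
`f ∈ A^p_α` iff `A_γ^{(q)}(R^{k+1} f) ∈ L^p(dv_α)`, with comparable norms. -/
theorem stmt8 (n : ℕ) (hn : 1 ≤ n) (γ q α p : ℝ) (k : ℕ) (hγ : 0 < γ) (hq : 1 < q)
    (hp : 0 < p) (hk : p * k + α > -1) :
    ∃ C : ℝ≥0∞, 0 < C ∧ C < ⊤ ∧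
      ∀ f : En n → ℂ, DifferentiableOn ℂ f (uball n) →
        ((gapnorm n p α f < ⊤ ↔
            (∫⁻ z, (areaF γ q
              (fun w => (1 - ‖w‖ ^ 2) ^ ((k : ℝ) + 1) * ‖radIter (k + 1) f w‖) z) ^ p
              ∂measA n α) < ⊤) ∧
         C⁻¹ * (ENNReal.ofReal ‖f 0‖ +
              (∫⁻ z, (areaF γ q
                (fun w => (1 - ‖w‖ ^ 2) ^ ((k : ℝ) + 1) * ‖radIter (k + 1) f w‖) z) ^ p
                ∂measA n α) ^ (1 / p)) ≤ gapnorm n p α f ∧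
         gapnorm n p α f ≤
            C * (ENNReal.ofReal ‖f 0‖ +
              (∫⁻ z, (areaF γ q
                (fun w => (1 - ‖w‖ ^ 2) ^ ((k : ℝ) + 1) * ‖radIter (k + 1) f w‖) z) ^ p
                ∂measA n α) ^ (1 / p))) := by
  have hmem : Nmin p α ∈ {k : ℕ | p * k + α > -1} := Nat.sInf_mem ⟨k, hk⟩
  have hle : Nmin p α ≤ k := Nat.sInf_le hk
  have hN : -1 < α + p * (Nmin p α : ℕ) := by
    have : p * (Nmin p α : ℕ) + α > -1 := hmem
    linarith
  obtain ⟨m, hm⟩ := Nat.exists_eq_add_of_le (hle.trans (Nat.le_succ k))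
  obtain ⟨C1, hC1, h1⟩ := easy_it n hp α (Nmin p α) m
  obtain ⟨C2, hC2, h2⟩ := hardy_it n hp α (Nmin p α) hN m
  obtain ⟨C3, hC3, h3⟩ := area_cmp n hγ (lt_trans one_pos hq) hp ((k : ℝ) + 1) α
  set c := ENNReal.ofReal (cnorm n α) with hc
  have hm' : Nmin p α + m = k + 1 := hm.symm
  rw [hm'] at h1 h2
  have hD : C3 * C1 + C2 + C2 * C3 ≠ ⊤ := by simp [ENNReal.mul_eq_top, hC1, hC2, hC3]
  obtain ⟨C, hC0, hCt, hfin⟩ := fin_alg hp (D := C3 * C1 + C2 + C2 * C3) (c := c) hD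
    ENNReal.ofReal_ne_top
  refine ⟨C, hC0, hCt, fun f hf => ?_⟩
  have e1 : gapnorm n p α f = ENNReal.ofReal ‖f 0‖ +
      (c * Yv p (α + p * (Nmin p α : ℕ)) (radIter (Nmin p α) f)) ^ (1 / p) := by
    unfold gapnorm
    congr 2
    rw [lint_A]
    congr 1
    unfold Yv
    apply setLIntegral_congr_fun (uball_meas n)
    intro z hz
    rw [mem_uball] at hz
    simp only
    rw [Wt_add hz, mul_assoc]
    congr 1
    change ENNReal.ofReal (dd z ^ _ * _) = _
    rw [ENNReal.ofReal_mul (Real.rpow_nonneg (dd_pos hz).le _),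
      ← ENNReal.ofReal_rpow_of_nonneg (norm_nonneg _) hp.le, ofReal_norm]
    rfl
  rw [e1, lint_A]
  have ha := h3 _ (radIter_diff hf (k + 1))
  have ee : α + ((k : ℝ) + 1) * p = α + p * ((k + 1 : ℕ) : ℝ) := by push_cast; ring
  rw [ee] at ha
  have g1 := h1 f hf
  have g2 := h2 f hf
  set X := ∫⁻ z in uball n, Wt α z *
    areaF γ q (fun w => (1 - ‖w‖ ^ 2) ^ ((k : ℝ) + 1) * ‖radIter (k + 1) f w‖) z ^ p ∂vol n with hX
  set Y := Yv p (α + p * (Nmin p α : ℕ)) (radIter (Nmin p α) f) with hY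
  set Z := Yv p (α + p * ((k + 1 : ℕ) : ℝ)) (radIter (k + 1) f) with hZ
  rw [ofReal_norm]
  refine hfin ‖f 0‖ₑ (c * X) (c * Y) enorm_ne_top ?_ ?_
  · calc c * X ≤ c * (C3 * (C1 * Y)) :=
          mul_le_mul_right (ha.2.trans (mul_le_mul_right g1 _)) _
      _ = C3 * C1 * (c * Y) := by ring
      _ ≤ _ := by
        refine mul_le_mul_left ?_ _
        rw [add_assoc]; exact le_self_add
  · calc c * Y ≤ c * (C2 * (‖f 0‖ₑ ^ p + C3 * X)) :=
          mul_le_mul_right (g2.trans (mul_le_mul_right (add_le_add le_rfl ha.1) _)) _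
      _ = C2 * (c * ‖f 0‖ₑ ^ p) + C2 * C3 * (c * X) := by ring
      _ ≤ (C3 * C1 + C2 + C2 * C3) * (c * ‖f 0‖ₑ ^ p) + (C3 * C1 + C2 + C2 * C3) * (c * X) := by
        refine add_le_add (mul_le_mul_left ?_ _) (mul_le_mul_left ?_ _)
        · rw [add_assoc, add_comm]
          rw [add_assoc]; exact le_self_add
        · exact le_add_self
      _ = _ := by ring
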